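/- Let n ≥ 1 and let ω : (0,∞) → [0,∞) be non-decreasing and satisfy the log-Dini(1) condition. Let K be a bilinear Calderón–Zygmund kernel of ω type with constant C₀ > 0 on ℝⁿ, and let T assign to each pair of integrable functions on ℝⁿ a measurable function, additively and homogeneously in each entry, with kernel representation: for all compactly supported f₁, f₂ ∈ L¹(ℝⁿ) and almost every x ∉ supp f₁ ∩ supp f₂, T(f₁,f₂)(x) = ∬ K(x,y₁,y₂)f₁(y₁)f₂(y₂) dy₁dy₂. Let b : ℝⁿ → ℝ be locally integrable with BMO seminorm ‖b‖_* < ∞ and set T_b(f₁,f₂) = b·T(f₁,f₂) − T(b·f₁, f₂). Assume there are C₁, C₂ > 0 such that λ·|{x : |T_b(f,g)(x)| > λ}| ≤ C₁‖f‖_{L²}‖g‖_{L²} for all bounded compactly supported f, g and all λ > 0, and |{x : |T(f,g)(x)| > λ}| ≤ (C₂‖f‖_{L¹}‖g‖_{L¹}/λ)^{1/2} for all f, g ∈ L¹(ℝⁿ) and λ > 0. Then there is a constant C, depending only on n, ω and ‖b‖_*, such that for every λ > 0 and all f₁, f₂ each of which is a finite sum f_j = ∑_k λ_{j,k} a_{j,k}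 of (1,∞,0)-atoms a_{j,k} supported on dyadic cubes with ∑_k |λ_{j,k}| ≤ 1, one has |{x ∈ ℝⁿ : |T_b(f₁,f₂)(x)| > λ}| ≤ C·(C₀+C₁+C₂)^{1/2}·λ^{−1/2}. -/

import Mathlib

open MeasureTheory Set
open scoped ENNReal

noncomputable section

/-- Euclidean space `ℝⁿ`. -/
abbrev Rn (n : ℕ) : Type := EuclideanSpace ℝ (Fin n)

/-- A dyadic cube `∏ [2^k mᵢ, 2^k (mᵢ+1))` in `ℝⁿ`. -/
def IsDyadicCube {n : ℕ} (Q : Set (Rn n)) : Prop :=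
  ∃ (k : ℤ) (m : Fin n → ℤ),
    Q = {x : Rn n | ∀ i, (2:ℝ) ^ k * (m i : ℝ) ≤ x i ∧ x i < (2:ℝ) ^ k * ((m i : ℝ) + 1)}

/-- The (closed) axis-parallel cube with center `c` and side length `l`. -/
def cube {n : ℕ} (c : Rn n) (l : ℝ) : Set (Rn n) :=
  {x : Rn n | ∀ i, |x i - c i| ≤ l / 2}

/-- The average `b_Q = |Q|⁻¹ ∫_Q b`. -/
def avgOn {n : ℕ} (b : Rn n → ℝ) (Q : Set (Rn n)) : ℝ := ⨍ x in Q, b x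

/-- `b` has mean oscillation at most `M` on every cube; i.e. `‖b‖_* ≤ M`. -/
def OscBound {n : ℕ} (b : Rn n → ℝ) (M : ℝ) : Prop :=
  ∀ (c : Rn n) (l : ℝ), 0 < l →
    ⨍ x in cube c l, |b x - avgOn b (cube c l)| ≤ M

/-- A `(1,∞,0)`-atom supported on the set `Q`. -/
def IsH1Atom {n : ℕ} (Q : Set (Rn n)) (a : Rn n → ℝ) : Prop :=
  Measurable a ∧ (∀ x, x ∉ Q → a x = 0) ∧
    (∀ᵐ x ∂volume, |a x| ≤ ((volume Q).toReal)⁻¹) ∧ (∫ x, a x) = 0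

/-- The `L¹` norm. -/
def l1norm {n : ℕ} (f : Rn n → ℝ) : ℝ := ∫ x, |f x|

/-- The `L²` norm. -/
def l2norm {n : ℕ} (f : Rn n → ℝ) : ℝ := (∫ x, (f x) ^ 2) ^ ((1:ℝ)/2)

/-- A finite sum `∑ λ_k a_k` of `(1,∞,0)`-atoms on dyadic cubes with `∑ |λ_k| ≤ 1`. -/
def FiniteAtomicSum {n : ℕ} (f : Rn n → ℝ) : Prop :=
  ∃ (N : ℕ) (Q : Fin N → Set (Rn n)) (a : Fin N → Rn n → ℝ) (lam : Fin N → ℝ),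
    (∀ k, IsDyadicCube (Q k)) ∧ (∀ k, IsH1Atom (Q k) (a k)) ∧
    (∑ k, |lam k|) ≤ 1 ∧ ∀ x, f x = ∑ k, lam k * a k x

/-- A bilinear Calderón–Zygmund kernel of `ω` type with constant `C₀` on `ℝⁿ`. -/
def IsCZKernel2 {n : ℕ} (C₀ : ℝ) (ω : ℝ → ℝ) (K : Rn n → Rn n → Rn n → ℝ) : Prop :=
  (∀ x y₁ y₂ : Rn n, ¬(x = y₁ ∧ y₁ = y₂) →
      |K x y₁ y₂| ≤ C₀ / (‖x - y₁‖ + ‖x - y₂‖) ^ (2 * n)) ∧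
  (∀ x x' y₁ y₂ : Rn n, ¬(x = y₁ ∧ y₁ = y₂) →
      ‖x - x'‖ ≤ (1/2) * max ‖x - y₁‖ ‖x - y₂‖ →
      |K x y₁ y₂ - K x' y₁ y₂| ≤
        C₀ / (‖x - y₁‖ + ‖x - y₂‖) ^ (2 * n) * ω (‖x - x'‖ / (‖x - y₁‖ + ‖x - y₂‖))) ∧
  (∀ x y₁ y₁' y₂ : Rn n, ¬(x = y₁ ∧ y₁ = y₂) →
      ‖y₁ - y₁'‖ ≤ (1/2) * max ‖x - y₁‖ ‖x - y₂‖ →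
      |K x y₁ y₂ - K x y₁' y₂| ≤
        C₀ / (‖x - y₁‖ + ‖x - y₂‖) ^ (2 * n) * ω (‖y₁ - y₁'‖ / (‖x - y₁‖ + ‖x - y₂‖))) ∧
  (∀ x y₁ y₂ y₂' : Rn n, ¬(x = y₁ ∧ y₁ = y₂) →
      ‖y₂ - y₂'‖ ≤ (1/2) * max ‖x - y₁‖ ‖x - y₂‖ →
      |K x y₁ y₂ - K x y₁ y₂'| ≤
        C₀ / (‖x - y₁‖ + ‖x - y₂‖) ^ (2 * n) * ω (‖y₂ - y₂'‖ / (‖x - y₁‖ + ‖x - y₂‖)))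

/-- `T` is additive and homogeneous in each of its two entries (on integrable functions). -/
def Bilin2 {n : ℕ} (T : (Rn n → ℝ) → (Rn n → ℝ) → Rn n → ℝ) : Prop :=
  (∀ f f' g : Rn n → ℝ, Integrable f → Integrable f' → Integrable g → ∀ x,
      T (fun y => f y + f' y) g x = T f g x + T f' g x) ∧
  (∀ (r : ℝ) (f g : Rn n → ℝ), Integrable f → Integrable g → ∀ x,
      T (fun y => r * f y) g x = r * T f g x) ∧
  (∀ f g g' : Rn n → ℝ, Integrable f → Integrable g → Integrable g' → ∀ x,
      T f (fun y => g y + g' y) x = T f g x + T f g' x) ∧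
  (∀ (r : ℝ) (f g : Rn n → ℝ), Integrable f → Integrable g → ∀ x,
      T f (fun y => r * g y) x = r * T f g x)

/-- `T` is represented by the kernel `K` off the support of the arguments. -/
def KernelRep2 {n : ℕ} (K : Rn n → Rn n → Rn n → ℝ)
    (T : (Rn n → ℝ) → (Rn n → ℝ) → Rn n → ℝ) : Prop :=
  ∀ f g : Rn n → ℝ, Integrable f → Integrable g →
    HasCompactSupport f → HasCompactSupport g →
    ∀ᵐ x ∂volume, x ∉ tsupport f ∩ tsupport g →
      T f g x = ∫ y : Rn n × Rn n, K x y.1 y.2 * f y.1 * g y.2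

/-! ### Cubes -/

section Cubes

variable {n : ℕ}

lemma isClosed_cube (c : Rn n) (l : ℝ) : IsClosed (cube c l) := by
  simp only [cube, ofPred_forall]
  exact isClosed_iInter fun i => isClosed_le (by fun_prop) continuous_const

lemma measurableSet_cube (c : Rn n) (l : ℝ) : MeasurableSet (cube c l) :=
  (isClosed_cube c l).measurableSet

lemma cube_mono (c : Rn n) {l l' : ℝ} (h : l ≤ l') : cube c l ⊆ cube c l' :=
  fun _ hx i => (hx i).trans (by linarith)

lemma norm_sub_le_of_mem_cube {c y : Rn n} {l : ℝ} (hl : 0 ≤ l) (hy : y ∈ cube c l) :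
    ‖y - c‖ ≤ 2 ^ n * (l / 2) := by
  have h1 : ‖y - c‖ ≤ n * (l / 2) := by
    rw [EuclideanSpace.norm_eq]
    refine Real.sqrt_le_iff.2 ⟨by positivity, ?_⟩
    calc ∑ i, ‖(y - c) i‖ ^ 2 ≤ ∑ _i : Fin n, (l / 2) ^ 2 := by
          refine Finset.sum_le_sum fun i _ => ?_
          have := hy i
          simp only [PiLp.sub_apply, Real.norm_eq_abs]
          gcongr
      _ = n * (l / 2) ^ 2 := by simp
      _ ≤ (n * (l / 2)) ^ 2 := by
          rw [mul_pow]
          gcongr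
          exact_mod_cast Nat.le_self_pow (by norm_num) n
  refine h1.trans ?_
  gcongr
  exact_mod_cast Nat.lt_two_pow_self.le

lemma isCompact_cube (c : Rn n) (l : ℝ) : IsCompact (cube c l) := by
  refine Metric.isCompact_of_isClosed_isBounded (isClosed_cube c l) ?_
  refine (Metric.isBounded_closedBall (x := c) (r := 2 ^ n * (|l| / 2))).subset fun y hy => ?_
  rw [mem_closedBall_iff_norm]
  exact norm_sub_le_of_mem_cube (abs_nonneg l) (cube_mono c (le_abs_self l) hy)

lemma lt_norm_sub_of_notMem_cube {c x y : Rn n} {L l : ℝ} (hx : x ∉ cube c L)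
    (hy : y ∈ cube c l) : (L - l) / 2 < ‖x - y‖ := by
  simp only [cube, mem_ofPred_eq, not_forall, not_le] at hx
  obtain ⟨i, hi⟩ := hx
  have h1 := PiLp.norm_apply_le (x - y) i
  have h2 := hy i
  have h3 : |x i - c i| ≤ |x i - y i| + |y i - c i| := abs_sub_le _ _ _
  simp only [PiLp.sub_apply, Real.norm_eq_abs] at h1
  linarith

lemma mem_cube_of_norm_sub_le {c x y : Rn n} {L r : ℝ} (hx : x ∈ cube c L)
    (hy : ‖y - x‖ ≤ r) : y ∈ cube c (L + 2 * r) := fun i => by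
  have h1 := (PiLp.norm_apply_le (y - x) i).trans hy
  have h3 : |y i - c i| ≤ |y i - x i| + |x i - c i| := abs_sub_le _ _ _
  simp only [PiLp.sub_apply, Real.norm_eq_abs] at h1
  linarith [hx i]

lemma exists_mem_cube_two_pow (c x : Rn n) {l : ℝ} (hl : 0 < l) :
    ∃ p : ℕ, x ∈ cube c (2 ^ p * l) := by
  obtain ⟨p, hp⟩ := pow_unbounded_of_one_lt (2 * ‖x - c‖ / l) (one_lt_two (α := ℝ))
  refine ⟨p, fun i => ?_⟩
  have h1 := PiLp.norm_apply_le (x - c) i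
  rw [div_lt_iff₀ hl] at hp
  simp only [PiLp.sub_apply, Real.norm_eq_abs] at h1
  linarith

lemma volume_coord_box (s : Fin n → Set ℝ) (hs : ∀ i, MeasurableSet (s i)) :
    volume {x : Rn n | ∀ i, x i ∈ s i} = ∏ i, volume (s i) := by
  rw [← volume_pi_pi,
    ← (PiLp.volume_preserving_ofLp (Fin n)).measure_preimage
      (MeasurableSet.univ_pi hs).nullMeasurableSet]
  congr 1
  ext x
  simp

lemma volume_cube (c : Rn n) {l : ℝ} (hl : 0 ≤ l) :
    volume (cube c l) = ENNReal.ofReal (l ^ n) := by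
  have : cube c l = {x : Rn n | ∀ i, x i ∈ Icc (c i - l / 2) (c i + l / 2)} := by
    ext x
    simp only [cube, mem_ofPred_eq, mem_Icc, abs_le]
    refine forall_congr' fun i => ⟨fun h => ⟨by linarith, by linarith⟩,
      fun h => ⟨by linarith, by linarith⟩⟩
  rw [this, volume_coord_box _ fun _ => measurableSet_Icc]
  simp [Real.volume_Icc, ENNReal.ofReal_pow hl]

lemma volume_real_cube (c : Rn n) {l : ℝ} (hl : 0 ≤ l) : volume.real (cube c l) = l ^ n := by
  rw [measureReal_def, volume_cube c hl, ENNReal.toReal_ofReal (by positivity)]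

end Cubes

/-! ### Dyadic cubes -/

section Dyadic

variable {n : ℕ}

/-- `Q` is a measurable subset of the cube of center `c` and side `l`, of full measure in it. -/
structure IsCubeLike (Q : Set (Rn n)) (c : Rn n) (l : ℝ) : Prop where
  side_pos : 0 < l
  subset : Q ⊆ cube c l
  measurable : MeasurableSet Q
  volume_eq : volume Q = ENNReal.ofReal (l ^ n)

lemma IsDyadicCube.exists_isCubeLike {Q : Set (Rn n)} (hQ : IsDyadicCube Q) :
    ∃ c l, IsCubeLike Q c l := by
  obtain ⟨k, m, rfl⟩ := hQ
  have h2 : (0:ℝ) < 2 ^ k := by positivity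
  have hm : MeasurableSet {x : Rn n | ∀ i, (2:ℝ) ^ k * (m i : ℝ) ≤ x i ∧
      x i < (2:ℝ) ^ k * ((m i : ℝ) + 1)} := by
    simp only [ofPred_forall]
    refine MeasurableSet.iInter fun i => ?_
    have hi : Measurable fun x : Rn n => x i := by fun_prop
    exact (measurableSet_le measurable_const hi).inter (measurableSet_lt hi measurable_const)
  refine ⟨WithLp.toLp 2 fun i => 2 ^ k * (m i + 1 / 2), 2 ^ k, h2, ?_, hm, ?_⟩
  · intro x hx i
    have := hx i
    simp only [abs_le]
    constructor <;> linarith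
  · have := volume_coord_box (fun i => Ico ((2:ℝ) ^ k * (m i : ℝ)) (2 ^ k * (m i + 1)))
      fun _ => measurableSet_Ico
    simp only [mem_Ico] at this
    rw [this]
    simp [Real.volume_Ico, mul_add, ENNReal.ofReal_pow h2.le]

lemma IsDyadicCube.subset_of_volume_le (hn : n ≠ 0) {Q R : Set (Rn n)} (hQ : IsDyadicCube Q)
    (hR : IsDyadicCube R) {x : Rn n} (hxQ : x ∈ Q) (hxR : x ∈ R) {c d : Rn n} {l s : ℝ}
    (hQl : IsCubeLike Q c l) (hRs : IsCubeLike R d s) (hls : l ≤ s) : Q ⊆ R := by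
  obtain ⟨k, m, rfl⟩ := hQ
  obtain ⟨k', m', rfl⟩ := hR
  have side : ∀ (k : ℤ) (m : Fin n → ℤ) (c : Rn n) (l : ℝ), IsCubeLike {x : Rn n | ∀ i,
      (2:ℝ) ^ k * (m i : ℝ) ≤ x i ∧ x i < (2:ℝ) ^ k * ((m i : ℝ) + 1)} c l → l = 2 ^ k := by
    intro k m c l h
    have h2 : (0:ℝ) < 2 ^ k := by positivity
    have h1 := h.volume_eq
    have := volume_coord_box (fun i => Ico ((2:ℝ) ^ k * (m i : ℝ)) (2 ^ k * (m i + 1)))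
      fun _ => measurableSet_Ico
    simp only [mem_Ico] at this
    rw [this] at h1
    simp only [Real.volume_Ico, mul_add, mul_one, add_sub_cancel_left, Finset.prod_const,
      Finset.card_univ, Fintype.card_fin] at h1
    rw [← ENNReal.ofReal_pow h2.le, ENNReal.ofReal_eq_ofReal_iff (by positivity)
      (pow_nonneg h.side_pos.le n)] at h1
    exact ((pow_left_inj₀ h2.le h.side_pos.le hn).1 h1).symm
  have hkk : k ≤ k' := by
    rw [side _ _ _ _ hQl, side _ _ _ _ hRs] at hls
    exact (zpow_le_zpow_iff_right₀ one_lt_two).1 hls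
  obtain ⟨d, rfl⟩ := Int.le.dest hkk
  have h2 : (0:ℝ) < 2 ^ k := by positivity
  have hz : (2:ℝ) ^ (k + d : ℤ) = 2 ^ k * ((2 ^ d : ℤ) : ℝ) := by
    rw [zpow_add₀ two_ne_zero]; push_cast; simp
  intro y hy i
  have hxQ := hxQ i
  have hxR := hxR i
  have hy := hy i
  rw [hz, mul_assoc, mul_assoc] at hxR ⊢
  have e1 : (m i : ℝ) < (2 ^ d : ℤ) * ((m' i : ℝ) + 1) :=
    lt_of_mul_lt_mul_left (hxQ.1.trans_lt hxR.2) h2.le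
  have e2 : ((2 ^ d : ℤ) : ℝ) * (m' i : ℝ) < m i + 1 :=
    lt_of_mul_lt_mul_left (hxR.1.trans_lt hxQ.2) h2.le
  have e1' : m i + 1 ≤ 2 ^ d * (m' i + 1) := by exact_mod_cast e1
  have e2' : 2 ^ d * m' i ≤ m i := Int.lt_add_one_iff.1 (by exact_mod_cast e2)
  have f1 : (m i : ℝ) + 1 ≤ (2 ^ d : ℤ) * ((m' i : ℝ) + 1) := by exact_mod_cast e1'
  have f2 : ((2 ^ d : ℤ) : ℝ) * (m' i : ℝ) ≤ m i := by exact_mod_cast e2'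
  exact ⟨(mul_le_mul_of_nonneg_left f2 h2.le).trans hy.1,
    hy.2.trans_le (mul_le_mul_of_nonneg_left f1 h2.le)⟩

end Dyadic

/-! ### The exceptional set -/

section Maximal

variable {n : ℕ}

/-- The points at which a centred maximal function of `F` exceeds `α`. -/
def maximalSet (F : Rn n → ℝ≥0∞) (α : ℝ) : Set (Rn n) :=
  {x | ∃ r : ℝ, 0 < r ∧ ENNReal.ofReal (α * r ^ n) < ∫⁻ y in Metric.closedBall x r, F y}

lemma lintegral_closedBall_le_of_notMem_maximalSet {F : Rn n → ℝ≥0∞} {α : ℝ} {x : Rn n}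
    (hx : x ∉ maximalSet F α) {r : ℝ} (hr : 0 < r) :
    ∫⁻ y in Metric.closedBall x r, F y ≤ ENNReal.ofReal (α * r ^ n) := by
  simp only [maximalSet, mem_ofPred_eq, not_exists, not_and, not_lt] at hx
  exact hx r hr

/-- The constant in the weak `L¹` bound for the maximal function. -/
def maximalConst (n : ℕ) : ℝ := 5 ^ n * volume.real (Metric.ball (0 : Rn n) 1)

lemma maximalConst_nonneg (n : ℕ) : 0 ≤ maximalConst n := by
  unfold maximalConst; positivity

lemma volume_closedBall_five_mul (x : Rn n) {r : ℝ} (hr : 0 ≤ r) :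
    volume (Metric.closedBall x (5 * r)) = ENNReal.ofReal (maximalConst n * r ^ n) := by
  rw [Measure.addHaar_closedBall _ _ (by positivity), finrank_euclideanSpace_fin,
    ← ofReal_measureReal (measure_ball_lt_top).ne, ← ENNReal.ofReal_mul (by positivity)]
  congr 1
  rw [maximalConst, mul_pow]
  ring

lemma volume_maximalSet_le (hn : 1 ≤ n) {F : Rn n → ℝ≥0∞} (hF : ∫⁻ x, F x ≤ 1) {α : ℝ}
    (hα : 0 < α) : volume (maximalSet F α) ≤ ENNReal.ofReal (maximalConst n / α) := by
  set t : Set (Rn n × ℝ) := {p | 0 < p.2 ∧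
    ENNReal.ofReal (α * p.2 ^ n) < ∫⁻ y in Metric.closedBall p.1 p.2, F y} with ht
  have hbd : ∀ p ∈ t, p.2 ≤ max 1 (1 / α) := by
    rintro p ⟨hp, hp'⟩
    have h1 : ENNReal.ofReal (α * p.2 ^ n) < 1 :=
      hp'.trans_le ((setLIntegral_le_lintegral _ _).trans hF)
    rw [← ENNReal.ofReal_one, ENNReal.ofReal_lt_ofReal_iff one_pos] at h1
    rcases le_total p.2 1 with h | h
    · exact h.trans (le_max_left _ _)
    · refine le_trans ?_ (le_max_right _ _)
      have h3 : p.2 ≤ p.2 ^ n := le_self_pow₀ h (by omega)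
      rw [le_div_iff₀ hα]
      nlinarith
  obtain ⟨u, hut, hdisj, hcov⟩ := Vitali.exists_disjoint_subfamily_covering_enlargement_closedBall
    t (fun p => p.1) (fun p => p.2) _ hbd 5 (by norm_num)
  have hcount : u.Countable := by
    refine hdisj.countable_of_nonempty_interior fun p hp => ?_
    exact ⟨p.1, Metric.ball_subset_interior_closedBall (Metric.mem_ball_self (hut hp).1)⟩
  have hsub : maximalSet F α ⊆ ⋃ p ∈ u, Metric.closedBall p.1 (5 * p.2) := by
    rintro x ⟨r, hr, hx⟩
    obtain ⟨p, hp, hsub⟩ := hcov (x, r) ⟨hr, hx⟩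
    exact mem_biUnion hp (hsub (Metric.mem_closedBall_self hr.le))
  have hcα : 0 ≤ maximalConst n / α := div_nonneg (maximalConst_nonneg n) hα.le
  calc volume (maximalSet F α) ≤ volume (⋃ p ∈ u, Metric.closedBall p.1 (5 * p.2)) :=
        measure_mono hsub
    _ ≤ ∑' p : u, volume (Metric.closedBall p.1.1 (5 * p.1.2)) := measure_biUnion_le _ hcount _
    _ ≤ ∑' p : u, ENNReal.ofReal (maximalConst n / α) *
          ∫⁻ y in Metric.closedBall p.1.1 p.1.2, F y := by
        refine ENNReal.tsum_le_tsum fun p => ?_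
        obtain ⟨hp, hp'⟩ := hut p.2
        rw [volume_closedBall_five_mul _ hp.le]
        refine le_trans (le_of_eq ?_) (mul_le_mul_right hp'.le _)
        rw [← ENNReal.ofReal_mul hcα]
        congr 1
        field_simp
    _ = ENNReal.ofReal (maximalConst n / α) *
          ∫⁻ y in ⋃ p ∈ u, Metric.closedBall p.1 p.2, F y := by
        rw [ENNReal.tsum_mul_left, lintegral_biUnion hcount
          (fun p _ => Metric.isClosed_closedBall.measurableSet) hdisj]
    _ ≤ ENNReal.ofReal (maximalConst n / α) * 1 := by
        gcongr
        exact (setLIntegral_le_lintegral _ _).trans hF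
    _ = _ := mul_one _

/-- Integration of a density against a tail `(r + |x - y|)^{-2n}`. -/
lemma lintegral_mul_tail_le (hn : 1 ≤ n) {G : Rn n → ℝ≥0∞} (hG : AEMeasurable G) {x : Rn n}
    {r β : ℝ} (hr : 0 < r) (hβ : 0 ≤ β)
    (h : ∀ i : ℕ, ∫⁻ y in Metric.closedBall x (2 ^ i * r), G y ≤
      ENNReal.ofReal (β * (1 + i) * (2 ^ i * r) ^ n)) :
    ∫⁻ y, G y * ENNReal.ofReal (((r + ‖x - y‖) ^ (2 * n))⁻¹) ≤
      ENNReal.ofReal (4 ^ (n + 1) * β * (r ^ n)⁻¹) := by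
  have hpt : ∀ y, G y * ENNReal.ofReal (((r + ‖x - y‖) ^ (2 * n))⁻¹) ≤
      ∑' i : ℕ, ENNReal.ofReal (((2 ^ i * r / 2) ^ (2 * n))⁻¹) *
        (Metric.closedBall x (2 ^ i * r)).indicator G y := by
    intro y
    have hex : ∃ i : ℕ, ‖x - y‖ ≤ 2 ^ i * r := by
      obtain ⟨i, hi⟩ := pow_unbounded_of_one_lt (‖x - y‖ / r) (one_lt_two (α := ℝ))
      exact ⟨i, ((div_lt_iff₀ hr).1 hi).le⟩
    classical
    obtain ⟨i, hi, hmin⟩ : ∃ i : ℕ, ‖x - y‖ ≤ 2 ^ i * r ∧ 2 ^ i * r / 2 ≤ r + ‖x - y‖ := by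
      refine ⟨Nat.find hex, Nat.find_spec hex, ?_⟩
      rcases hk : Nat.find hex with _ | k
      · have := norm_nonneg (x - y)
        simp only [pow_zero, one_mul]; linarith
      · have := Nat.find_min hex (m := k) (by omega)
        rw [pow_succ]
        linarith
    refine le_trans ?_ (ENNReal.le_tsum i)
    have hy : y ∈ Metric.closedBall x (2 ^ i * r) := by
      rwa [Metric.mem_closedBall, dist_comm, dist_eq_norm]
    rw [indicator_of_mem hy, mul_comm]
    gcongr
  have hsum : HasSum (fun i : ℕ => 4 ^ n * β * (r ^ n)⁻¹ * ((1 + i) * (1 / 2 : ℝ) ^ i))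
      (4 ^ n * β * (r ^ n)⁻¹ * 4) := by
    refine HasSum.mul_left _ ?_
    have h1 := hasSum_geometric_two
    have h2 := hasSum_coe_mul_geometric_of_norm_lt_one (r := (1 / 2 : ℝ)) (by norm_num)
    have h3 := h1.add h2
    have e : (2 : ℝ) + 1 / 2 / (1 - 1 / 2) ^ 2 = 4 := by norm_num
    rw [e] at h3
    exact h3.congr_fun fun i => by ring
  calc _ ≤ ∫⁻ y, ∑' i : ℕ, ENNReal.ofReal (((2 ^ i * r / 2) ^ (2 * n))⁻¹) *
        (Metric.closedBall x (2 ^ i * r)).indicator G y := lintegral_mono hpt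
    _ = ∑' i : ℕ, ENNReal.ofReal (((2 ^ i * r / 2) ^ (2 * n))⁻¹) *
        ∫⁻ y in Metric.closedBall x (2 ^ i * r), G y := by
      have hm : ∀ i : ℕ, MeasurableSet (Metric.closedBall x (2 ^ i * r)) := fun i =>
        Metric.isClosed_closedBall.measurableSet
      rw [lintegral_tsum fun i => (hG.indicator (hm i)).const_mul _]
      refine tsum_congr fun i => ?_
      rw [lintegral_const_mul'' _ (hG.indicator (hm i)), lintegral_indicator (hm i)]
    _ ≤ ∑' i : ℕ, ENNReal.ofReal (4 ^ n * β * (r ^ n)⁻¹ * ((1 + i) * (1 / 2 : ℝ) ^ i)) := by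
      refine ENNReal.tsum_le_tsum fun i => ?_
      refine (mul_le_mul_right (h i) _).trans ?_
      rw [← ENNReal.ofReal_mul (by positivity)]
      refine ENNReal.ofReal_le_ofReal ?_
      have h2 : ((2:ℝ) ^ i)⁻¹ ^ n ≤ ((2:ℝ) ^ i)⁻¹ ^ 1 :=
        pow_le_pow_of_le_one (by positivity) (inv_le_one_of_one_le₀ (one_le_pow₀ one_le_two)) hn
      have e : ((2 ^ i * r / 2) ^ (2 * n))⁻¹ * (β * (1 + i) * (2 ^ i * r) ^ n) =
          4 ^ n * β * (r ^ n)⁻¹ * (1 + i) * ((2:ℝ) ^ i)⁻¹ ^ n := by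
        rw [pow_mul', div_pow, div_pow, ← pow_mul 2 n 2, pow_mul' 2 n 2]
        norm_num
        field_simp
        rw [mul_pow]
        ring
      rw [e, one_div, inv_pow (2 : ℝ) i, ← mul_assoc]
      simp only [pow_one] at h2
      gcongr
    _ = ENNReal.ofReal (4 ^ (n + 1) * β * (r ^ n)⁻¹) := by
      rw [← ENNReal.ofReal_tsum_of_nonneg (fun i => by positivity) hsum.summable, hsum.tsum_eq]
      congr 1
      ring

end Maximal

/-! ### Functions of bounded mean oscillation -/

section BMO

variable {n : ℕ} {b : Rn n → ℝ} {M : ℝ}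

lemma integrableOn_cube (hb : LocallyIntegrable b volume) (c : Rn n) (l : ℝ) :
    IntegrableOn b (cube c l) := hb.integrableOn_isCompact (isCompact_cube c l)

lemma integrableOn_cube_abs_sub_const (hb : LocallyIntegrable b volume) (c : Rn n) (l a : ℝ) :
    IntegrableOn (fun x => |b x - a|) (cube c l) :=
  ((integrableOn_cube hb c l).sub
    (integrableOn_const (isCompact_cube c l).measure_lt_top.ne)).abs

lemma OscBound.setIntegral_le (hO : OscBound b M) (c : Rn n) {l : ℝ} (hl : 0 < l) :
    ∫ x in cube c l, |b x - avgOn b (cube c l)| ≤ l ^ n * M := by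
  have h := hO c l hl
  rw [setAverage_eq, volume_real_cube c hl.le, smul_eq_mul, inv_mul_le_iff₀ (by positivity)] at h
  exact h

lemma abs_avgOn_sub_mul_le (hb : LocallyIntegrable b volume) (c : Rn n) {l : ℝ} (hl : 0 < l)
    (a : ℝ) : |avgOn b (cube c l) - a| * l ^ n ≤ ∫ x in cube c l, |b x - a| := by
  have h1 : (avgOn b (cube c l) - a) * l ^ n = ∫ x in cube c l, (b x - a) := by
    rw [integral_sub (integrableOn_cube hb c l)
      (integrableOn_const (isCompact_cube c l).measure_lt_top.ne), avgOn, setAverage_eq,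
      setIntegral_const, volume_real_cube c hl.le, smul_eq_mul, smul_eq_mul]
    field_simp
  rw [← abs_of_nonneg (show 0 ≤ l ^ n by positivity), ← abs_mul, h1]
  exact abs_integral_le_integral_abs

lemma OscBound.abs_avgOn_sub_avgOn_le (hO : OscBound b M) (hb : LocallyIntegrable b volume)
    (c : Rn n) {l : ℝ} (hl : 0 < l) (p : ℕ) :
    |avgOn b (cube c (2 ^ p * l)) - avgOn b (cube c l)| ≤ p * (2 ^ n * M) := by
  induction p with
  | zero => simp
  | succ p ih =>
    have hs : 0 < 2 ^ p * l := by positivity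
    have e : (2:ℝ) ^ (p + 1) * l = 2 * (2 ^ p * l) := by ring
    rw [e]
    set s := 2 ^ p * l
    have h1 := abs_avgOn_sub_mul_le hb c hs (avgOn b (cube c (2 * s)))
    have h2 : ∫ x in cube c s, |b x - avgOn b (cube c (2 * s))| ≤
        ∫ x in cube c (2 * s), |b x - avgOn b (cube c (2 * s))| :=
      setIntegral_mono_set (integrableOn_cube_abs_sub_const hb c _ _)
        (ae_of_all _ fun x => abs_nonneg _) (cube_mono c (by linarith)).eventuallyLE
    have h3 := hO.setIntegral_le c (l := 2 * s) (by positivity)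
    have h4 : |avgOn b (cube c s) - avgOn b (cube c (2 * s))| ≤ 2 ^ n * M := by
      refine le_of_mul_le_mul_right ?_ (pow_pos hs n)
      calc _ ≤ _ := h1.trans (h2.trans h3)
        _ = _ := by rw [mul_pow]; ring
    rw [abs_sub_comm] at h4
    have := abs_sub_le (avgOn b (cube c (2 * s))) (avgOn b (cube c s)) (avgOn b (cube c l))
    push_cast
    linarith

lemma OscBound.lintegral_cube_le (hO : OscBound b M) (hb : LocallyIntegrable b volume)
    (c : Rn n) {l : ℝ} (hl : 0 < l) (p : ℕ) :
    ∫⁻ x in cube c (2 ^ p * l), ‖b x - avgOn b (cube c l)‖ₑ ≤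
      ENNReal.ofReal ((2 ^ p * l) ^ n * ((1 + p * 2 ^ n) * M)) := by
  have hs : 0 < 2 ^ p * l := by positivity
  simp only [Real.enorm_eq_ofReal_abs]
  rw [← ofReal_integral_eq_lintegral_ofReal (integrableOn_cube_abs_sub_const hb c _ _)
    (ae_of_all _ fun x => abs_nonneg _)]
  refine ENNReal.ofReal_le_ofReal ?_
  set s := 2 ^ p * l
  calc ∫ x in cube c s, |b x - avgOn b (cube c l)|
      ≤ ∫ x in cube c s, (|b x - avgOn b (cube c s)| +
          |avgOn b (cube c s) - avgOn b (cube c l)|) := by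
        refine integral_mono (integrableOn_cube_abs_sub_const hb c _ _)
          ((integrableOn_cube_abs_sub_const hb c _ _).add
            (integrableOn_const (isCompact_cube c s).measure_lt_top.ne)) fun x => ?_
        exact abs_sub_le _ _ _
    _ = (∫ x in cube c s, |b x - avgOn b (cube c s)|) +
          s ^ n * |avgOn b (cube c s) - avgOn b (cube c l)| := by
        rw [integral_add (integrableOn_cube_abs_sub_const hb c _ _)
          (integrableOn_const (isCompact_cube c s).measure_lt_top.ne), setIntegral_const,
          volume_real_cube c hs.le, smul_eq_mul]
    _ ≤ s ^ n * M + s ^ n * (p * (2 ^ n * M)) := by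
        gcongr
        · exact hO.setIntegral_le c hs
        · exact hO.abs_avgOn_sub_avgOn_le hb c hl p
    _ = _ := by ring

end BMO

/-! ### The log-Dini condition -/

section Dini

variable {ω : ℝ → ℝ}

/-- The dyadic form of the log-Dini integral. -/
def diniSum (ω : ℝ → ℝ) : ℝ≥0∞ := ∑' i : ℕ, ENNReal.ofReal (ω ((1 / 2) ^ (i + 1)) * (1 + i))

lemma diniSum_lt_top (hω0 : ∀ t, 0 < t → 0 ≤ ω t)
    (hωmono : ∀ s t : ℝ, 0 < s → s ≤ t → ω s ≤ ω t)
    (hω : IntegrableOn (fun t => ω t * (1 + Real.log (1 / t)) / t) (Ioo (0:ℝ) 1)) :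
    diniSum ω < ∞ := by
  set φ : ℝ → ℝ := fun t => ω t * (1 + Real.log (1 / t)) / t with hφ
  set I : ℕ → Set ℝ := fun i => Ioo ((1 / 2 : ℝ) ^ (i + 1)) ((1 / 2) ^ i) with hI
  have hpow : ∀ {i j : ℕ}, i ≤ j → (1 / 2 : ℝ) ^ j ≤ (1 / 2) ^ i := fun h =>
    pow_le_pow_of_le_one (by norm_num) (by norm_num) h
  have hdisj : Pairwise (Function.onFun Disjoint I) := by
    have key : ∀ i j, i < j → Disjoint (I i) (I j) := fun i j hij => by
      refine disjoint_left.2 fun t ht ht' => ?_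
      exact absurd (ht.1.trans ht'.2) (not_lt.2 (hpow hij))
    intro i j hij
    rcases lt_or_gt_of_ne hij with h | h
    · exact key i j h
    · exact (key j i h).symm
  have hsub : ⋃ i, I i ⊆ Ioo (0:ℝ) 1 := iUnion_subset fun i t ht =>
    ⟨lt_trans (by positivity) ht.1, ht.2.trans_le (pow_le_one₀ (by norm_num) (by norm_num))⟩
  have hterm : ∀ i : ℕ, ENNReal.ofReal (ω ((1 / 2) ^ (i + 1)) * (1 + i)) ≤
      4 * ∫⁻ t in I i, ENNReal.ofReal (φ t) := by
    intro i
    set s : ℝ := (1 / 2) ^ (i + 1) with hs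
    have hs0 : 0 < s := by positivity
    have hωs := hω0 s hs0
    have h2 : (1 / 2 : ℝ) ^ i = 2 * s := by rw [hs, pow_succ]; ring
    have hlow : ∀ t ∈ I i, ENNReal.ofReal (ω s * (1 + i) / (4 * s)) ≤ ENNReal.ofReal (φ t) := by
      intro t ht
      have ht0 : 0 < t := hs0.trans ht.1
      have hlog : (1 + i : ℝ) / 2 ≤ 1 + Real.log (1 / t) := by
        have h3 : Real.log (2 ^ i) ≤ Real.log (1 / t) := by
          refine Real.log_le_log (by positivity) ?_
          rw [le_div_iff₀ ht0]
          have h4 := ht.2.le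
          calc (2:ℝ) ^ i * t ≤ 2 ^ i * (1 / 2) ^ i := by gcongr
            _ = 1 := by rw [← mul_pow]; norm_num
        rw [Real.log_pow] at h3
        have := Real.log_two_gt_d9
        nlinarith [(Nat.cast_nonneg i : (0:ℝ) ≤ i)]
      refine ENNReal.ofReal_le_ofReal ?_
      have h5 : t ≤ 2 * s := h2 ▸ ht.2.le
      calc ω s * (1 + i) / (4 * s) = ω s * ((1 + i) / 2) / (2 * s) := by field_simp; norm_num
        _ ≤ ω t * (1 + Real.log (1 / t)) / t := by
          have h6 := hωmono s t hs0 ht.1.le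
          have h7 : 0 ≤ ω t := hω0 t ht0
          have h8 : 0 ≤ 1 + Real.log (1 / t) := le_trans (by positivity) hlog
          gcongr
    calc ENNReal.ofReal (ω s * (1 + i))
        = 4 * (ENNReal.ofReal (ω s * (1 + i) / (4 * s)) * volume (I i)) := by
          rw [hI, Real.volume_Ioo, ← hs, h2, ← ENNReal.ofReal_mul (by positivity),
            show (4 : ℝ≥0∞) = ENNReal.ofReal 4 by norm_num,
            ← ENNReal.ofReal_mul (by positivity)]
          congr 1
          field_simp
          ring
      _ ≤ 4 * ∫⁻ t in I i, ENNReal.ofReal (φ t) := by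
          rw [← setLIntegral_const]
          gcongr 4 * ?_
          exact setLIntegral_mono' measurableSet_Ioo hlow
  calc diniSum ω ≤ ∑' i, 4 * ∫⁻ t in I i, ENNReal.ofReal (φ t) := ENNReal.tsum_le_tsum hterm
    _ = 4 * ∫⁻ t in ⋃ i, I i, ENNReal.ofReal (φ t) := by
      rw [ENNReal.tsum_mul_left, lintegral_iUnion (fun i => measurableSet_Ioo) hdisj]
    _ ≤ 4 * ∫⁻ t in Ioo (0:ℝ) 1, ‖φ t‖ₑ := by
      gcongr 4 * ?_
      refine (lintegral_mono_set hsub).trans (lintegral_mono fun t => ?_)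
      rw [Real.enorm_eq_ofReal_abs]
      exact ENNReal.ofReal_le_ofReal (le_abs_self _)
    _ < ∞ := ENNReal.mul_lt_top (by norm_num) hω.2

lemma tendsto_zero_of_diniSum_lt_top (hω0 : ∀ t, 0 < t → 0 ≤ ω t) (h : diniSum ω < ∞) :
    Filter.Tendsto (fun i : ℕ => ω ((1 / 2) ^ (i + 1))) Filter.atTop (nhds 0) := by
  have h1 := ENNReal.tendsto_atTop_zero_of_tsum_ne_top h.ne
  have h2 := (ENNReal.tendsto_toReal ENNReal.zero_ne_top).comp h1
  refine squeeze_zero (fun i => hω0 _ (by positivity)) (fun i => ?_) h2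
  have := hω0 ((1 / 2) ^ (i + 1)) (by positivity)
  simp only [Function.comp_apply]
  rw [ENNReal.toReal_ofReal (by positivity)]
  nlinarith [(Nat.cast_nonneg i : (0:ℝ) ≤ i)]

end Dini

/-! ### Atoms and kernel estimates -/

section Atoms

variable {n : ℕ}

lemma integrable_sub_const_mul {b g : Rn n → ℝ} (hb : LocallyIntegrable b volume)
    (hg : Measurable g) {B : ℝ} (hB : ∀ x, |g x| ≤ B) (hs : HasCompactSupport g) (e : ℝ) :
    Integrable fun x => (b x - e) * g x := by
  have h1 : IntegrableOn (fun x => g x * (b x - e)) (tsupport g) := by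
    refine Integrable.bdd_mul (c := B) ?_ hg.aestronglyMeasurable (ae_of_all _ hB)
    exact (hb.integrableOn_isCompact hs).sub
      (integrableOn_const (IsCompact.measure_lt_top hs).ne)
  refine (integrableOn_iff_integrable_of_support_subset (s := tsupport g) ?_).1
    (h1.congr (ae_of_all _ fun x => mul_comm _ _))
  exact (Function.support_mul_subset_right _ _).trans (subset_tsupport g)

/-- An atom on the cube of center `c` and side `l`, bounded everywhere. -/
structure IsCubeAtom (c : Rn n) (l : ℝ) (a : Rn n → ℝ) : Prop where
  side_pos : 0 < l
  measurable : Measurable a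
  eq_zero : ∀ x, x ∉ cube c l → a x = 0
  abs_le : ∀ x, |a x| ≤ (l ^ n)⁻¹
  integral_eq_zero : ∫ x, a x = 0

variable {c : Rn n} {l : ℝ} {a : Rn n → ℝ}

lemma IsCubeAtom.enorm_le (ha : IsCubeAtom c l a) (x : Rn n) :
    ‖a x‖ₑ ≤ (cube c l).indicator (fun _ => ENNReal.ofReal ((l ^ n)⁻¹)) x := by
  by_cases hx : x ∈ cube c l
  · rw [indicator_of_mem hx, Real.enorm_eq_ofReal_abs]
    exact ENNReal.ofReal_le_ofReal (ha.abs_le x)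
  · simp [ha.eq_zero x hx]

lemma IsCubeAtom.lintegral_enorm_le_one (ha : IsCubeAtom c l a) : ∫⁻ x, ‖a x‖ₑ ≤ 1 := by
  refine (lintegral_mono ha.enorm_le).trans ?_
  have := pow_pos ha.side_pos n
  rw [lintegral_indicator (measurableSet_cube c l), setLIntegral_const,
    volume_cube c ha.side_pos.le, ← ENNReal.ofReal_mul (by positivity),
    inv_mul_cancel₀ this.ne', ENNReal.ofReal_one]

lemma IsCubeAtom.integrable (ha : IsCubeAtom c l a) : Integrable a :=
  ⟨ha.measurable.aestronglyMeasurable, ha.lintegral_enorm_le_one.trans_lt ENNReal.one_lt_top⟩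

lemma IsCubeAtom.tsupport_subset (ha : IsCubeAtom c l a) : tsupport a ⊆ cube c l :=
  closure_minimal (fun x hx => by_contra fun h => hx (ha.eq_zero x h)) (isClosed_cube c l)

lemma IsCubeAtom.hasCompactSupport (ha : IsCubeAtom c l a) : HasCompactSupport a :=
  HasCompactSupport.intro (isCompact_cube c l) ha.eq_zero

lemma IsCubeAtom.integrable_mul (ha : IsCubeAtom c l a) {b : Rn n → ℝ}
    (hb : LocallyIntegrable b volume) (e : ℝ) : Integrable fun x => (b x - e) * a x :=
  integrable_sub_const_mul hb ha.measurable ha.abs_le ha.hasCompactSupport e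

lemma IsCubeAtom.lintegral_mul_le (ha : IsCubeAtom c l a) {b : Rn n → ℝ} {M : ℝ}
    (hb : LocallyIntegrable b volume) (hO : OscBound b M) :
    ∫⁻ x, ‖(b x - avgOn b (cube c l)) * a x‖ₑ ≤ ENNReal.ofReal M := by
  have hl := pow_pos ha.side_pos n
  calc ∫⁻ x, ‖(b x - avgOn b (cube c l)) * a x‖ₑ
      ≤ ∫⁻ x, (cube c l).indicator (fun x => ENNReal.ofReal ((l ^ n)⁻¹) *
          ‖b x - avgOn b (cube c l)‖ₑ) x := by
        refine lintegral_mono fun x => ?_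
        rw [enorm_mul, mul_comm]
        refine (mul_le_mul_left (ha.enorm_le x) _).trans (le_of_eq ?_)
        by_cases hx : x ∈ cube c l <;> simp [hx]
    _ = ENNReal.ofReal ((l ^ n)⁻¹) * ∫⁻ x in cube c l, ‖b x - avgOn b (cube c l)‖ₑ := by
        rw [lintegral_indicator (measurableSet_cube c l), lintegral_const_mul' _ _ (by simp)]
    _ ≤ ENNReal.ofReal ((l ^ n)⁻¹) * ENNReal.ofReal (l ^ n * M) := by
        gcongr
        simpa using hO.lintegral_cube_le hb c ha.side_pos 0
    _ = ENNReal.ofReal M := by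
        rw [← ENNReal.ofReal_mul (by positivity), inv_mul_cancel_left₀ hl.ne']

end Atoms

section Kernel

variable {n : ℕ} {C₀ : ℝ} {ω : ℝ → ℝ} {K : Rn n → Rn n → Rn n → ℝ}

lemma IsCZKernel2.swap (hK : IsCZKernel2 C₀ ω K) : IsCZKernel2 C₀ ω fun x y₁ y₂ => K x y₂ y₁ := by
  obtain ⟨h0, h1, h2, h3⟩ := hK
  have hd : ∀ {x y₁ y₂ : Rn n}, ¬(x = y₁ ∧ y₁ = y₂) → ¬(x = y₂ ∧ y₂ = y₁) :=
    fun h h' => h ⟨h'.1.trans h'.2, h'.2.symm⟩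
  refine ⟨fun x y₁ y₂ h => ?_, fun x x' y₁ y₂ h hx => ?_, fun x y₁ y₁' y₂ h hx => ?_,
    fun x y₁ y₂ y₂' h hx => ?_⟩
  · rw [add_comm]; exact h0 _ _ _ (hd h)
  · rw [add_comm]; rw [max_comm] at hx; exact h1 _ _ _ _ (hd h) hx
  · rw [add_comm]; rw [max_comm] at hx; exact h3 _ _ _ _ (hd h) hx
  · rw [add_comm]; rw [max_comm] at hx; exact h2 _ _ _ _ (hd h) hx

lemma KernelRep2.swap {T : (Rn n → ℝ) → (Rn n → ℝ) → Rn n → ℝ} (hT : KernelRep2 K T) :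
    KernelRep2 (fun x y₁ y₂ => K x y₂ y₁) fun f g => T g f := by
  intro f g hf hg hf' hg'
  filter_upwards [hT g f hg hf hg' hf'] with x hx hx'
  rw [hx (by rwa [inter_comm])]
  have := (Measure.measurePreserving_swap (μ := (volume : Measure (Rn n)))
    (ν := (volume : Measure (Rn n)))).integral_comp
    (MeasurableEquiv.prodComm.measurableEmbedding)
    fun y : Rn n × Rn n => K x y.1 y.2 * g y.1 * f y.2
  rw [← Measure.volume_eq_prod] at this
  rw [← this]
  refine integral_congr_ae (ae_of_all _ fun y => ?_)
  simp only [Prod.fst_swap, Prod.snd_swap]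
  ring

lemma IsCZKernel2.continuous (hK : IsCZKernel2 C₀ ω K) (hC₀ : 0 < C₀)
    (hω0 : ∀ t, 0 < t → 0 ≤ ω t) (hωmono : ∀ s t : ℝ, 0 < s → s ≤ t → ω s ≤ ω t)
    (hω : diniSum ω < ∞) {x c : Rn n} (hxc : x ≠ c) : Continuous fun y => K x c y := by
  set D := ‖x - c‖ with hD
  have hD0 : 0 < D := norm_pos_iff.2 (sub_ne_zero.2 hxc)
  refine continuous_iff_continuousAt.2 fun y => Metric.continuousAt_iff.2 fun ε hε => ?_
  have hlim := (tendsto_zero_of_diniSum_lt_top hω0 hω).const_mul (C₀ / D ^ (2 * n))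
  rw [mul_zero] at hlim
  obtain ⟨i, hi⟩ := (hlim.eventually (gt_mem_nhds hε)).exists
  refine ⟨D * (1 / 2) ^ (i + 1), by positivity, fun {y'} hy' => ?_⟩
  rcases eq_or_ne y y' with rfl | hne
  · simpa using hε
  rw [dist_comm, dist_eq_norm] at hy'
  have hpos : 0 < ‖y - y'‖ := norm_pos_iff.2 (sub_ne_zero.2 hne)
  have hhalf : (1 / 2 : ℝ) ^ (i + 1) ≤ 1 / 2 := by
    rw [pow_succ]
    have : (1 / 2 : ℝ) ^ i ≤ 1 := pow_le_one₀ (by norm_num) (by norm_num)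
    linarith
  have h1 : ‖y - y'‖ ≤ 1 / 2 * max ‖x - c‖ ‖x - y‖ := by
    refine hy'.le.trans ?_
    have : D ≤ max ‖x - c‖ ‖x - y‖ := le_max_left _ _
    nlinarith
  have h2 := hK.2.2.2 x c y y' (fun h => hxc h.1) h1
  have hS : D ≤ ‖x - c‖ + ‖x - y‖ := by linarith [norm_nonneg (x - y)]
  rw [dist_comm, Real.dist_eq]
  refine (h2.trans ?_).trans_lt hi
  have h3 : ‖y - y'‖ / (‖x - c‖ + ‖x - y‖) ≤ (1 / 2) ^ (i + 1) := by
    rw [div_le_iff₀ (hD0.trans_le hS)]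
    refine hy'.le.trans ?_
    rw [mul_comm]
    gcongr
  have h4 : 0 < ‖y - y'‖ / (‖x - c‖ + ‖x - y‖) := div_pos hpos (hD0.trans_le hS)
  have h5 := hω0 _ h4
  have h6 := hωmono _ _ h4 h3
  gcongr

lemma enorm_integral_kernel_atom_le (hK : IsCZKernel2 C₀ ω K) (hC₀ : 0 < C₀)
    (hω0 : ∀ t, 0 < t → 0 ≤ ω t) (hωmono : ∀ s t : ℝ, 0 < s → s ≤ t → ω s ≤ ω t)
    (hω : diniSum ω < ∞) {c : Rn n} {l : ℝ} {a h : Rn n → ℝ} (ha : IsCubeAtom c l a)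
    (hh : Integrable h) (i : ℕ) {x : Rn n} (hx : x ∉ cube c (2 ^ (n + 2 + i) * l)) :
    ‖∫ y : Rn n × Rn n, K x y.1 y.2 * a y.1 * h y.2‖ₑ ≤
      ENNReal.ofReal (C₀ * ω ((1 / 2) ^ (i + 1))) *
        ∫⁻ y, ‖h y‖ₑ * ENNReal.ofReal (((2 ^ (n + i) * l + ‖x - y‖) ^ (2 * n))⁻¹) := by
  by_cases hint : Integrable fun y : Rn n × Rn n => K x y.1 y.2 * a y.1 * h y.2
  swap
  · rw [integral_undef hint]; simp
  have hl := ha.side_pos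
  set r := 2 ^ (n + i) * l with hr
  have hr0 : 0 < r := by positivity
  have hnl : 2 ^ n * l ≤ r := by
    rw [hr]; gcongr
    · norm_num
    · omega
  have hll : l ≤ r := le_trans (le_mul_of_one_le_left hl.le (one_le_pow₀ one_le_two)) hnl
  have hdist : ∀ y ∈ cube c l, r < ‖x - y‖ := fun y hy => by
    have h1 := lt_norm_sub_of_notMem_cube hx hy
    have e : (2:ℝ) ^ (n + 2 + i) * l = 4 * r := by rw [hr]; ring
    rw [e] at h1
    linarith
  have hc : c ∈ cube c l := fun j => by simpa using (half_pos hl).le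
  have hxc : r < ‖x - c‖ := hdist c hc
  have hxc' : x ≠ c := by
    rintro rfl
    simp only [sub_self, norm_zero] at hxc
    linarith
  have hωi : 0 ≤ ω ((1 / 2) ^ (i + 1)) := hω0 _ (by positivity)
  have hKc : Integrable fun y => K x c y * h y := by
    refine Integrable.bdd_mul (c := C₀ / r ^ (2 * n)) hh
      (hK.continuous hC₀ hω0 hωmono hω hxc').aestronglyMeasurable
      (ae_of_all _ fun y => (hK.1 x c y fun h => hxc' h.1).trans ?_)
    have : r ≤ ‖x - c‖ + ‖x - y‖ := by linarith [norm_nonneg (x - y)]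
    gcongr
  have hKc' : Integrable fun y : Rn n × Rn n => a y.1 * (K x c y.2 * h y.2) :=
    ha.integrable.mul_prod hKc
  have hzero : ∫ y : Rn n × Rn n, a y.1 * (K x c y.2 * h y.2) = 0 := by
    rw [Measure.volume_eq_prod, integral_prod_mul a fun y => K x c y * h y,
      ha.integral_eq_zero, zero_mul]
  rw [← sub_zero (∫ y : Rn n × Rn n, K x y.1 y.2 * a y.1 * h y.2), ← hzero,
    ← integral_sub hint hKc']
  refine (enorm_integral_le_lintegral_enorm _).trans ?_
  have hpt : ∀ y : Rn n × Rn n, ‖K x y.1 y.2 * a y.1 * h y.2 - a y.1 * (K x c y.2 * h y.2)‖ₑ ≤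
      ENNReal.ofReal (C₀ * ω ((1 / 2) ^ (i + 1))) * (‖a y.1‖ₑ *
        (‖h y.2‖ₑ * ENNReal.ofReal (((r + ‖x - y.2‖) ^ (2 * n))⁻¹))) := by
    rintro ⟨y, z⟩
    have e : K x y z * a y * h z - a y * (K x c z * h z) = (K x y z - K x c z) * (a y * h z) := by
      ring
    simp only
    rw [e, enorm_mul, enorm_mul]
    by_cases hy : y ∈ cube c l
    swap
    · simp [ha.eq_zero y hy]
    have hxy := hdist y hy
    have hyc := norm_sub_le_of_mem_cube hl.le hy
    have hxy' : x ≠ y := by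
      rintro rfl
      simp only [sub_self, norm_zero] at hxy
      linarith
    have hden : r + ‖x - z‖ ≤ ‖x - y‖ + ‖x - z‖ := by linarith
    have hz := norm_nonneg (x - z)
    have hbound : |K x y z - K x c z| ≤
        C₀ * ω ((1 / 2) ^ (i + 1)) * ((r + ‖x - z‖) ^ (2 * n))⁻¹ := by
      rcases eq_or_ne y c with rfl | hne
      · simp only [sub_self, abs_zero]; positivity
      have h1 : ‖y - c‖ ≤ 1 / 2 * max ‖x - y‖ ‖x - z‖ := by
        have := le_max_left ‖x - y‖ ‖x - z‖
        linarith
      refine (hK.2.2.1 x y c z (fun h => hxy' h.1) h1).trans ?_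
      have hpos : 0 < ‖x - y‖ + ‖x - z‖ := by linarith
      have h4 : 0 < ‖y - c‖ / (‖x - y‖ + ‖x - z‖) :=
        div_pos (norm_pos_iff.2 (sub_ne_zero.2 hne)) hpos
      have h3 : ‖y - c‖ / (‖x - y‖ + ‖x - z‖) ≤ (1 / 2) ^ (i + 1) := by
        rw [div_le_iff₀ hpos]
        have e : (1 / 2 : ℝ) ^ (i + 1) * r = 2 ^ n * (l / 2) := by
          rw [hr, pow_add, pow_succ, one_div, inv_pow]
          field_simp
          ring
        calc ‖y - c‖ ≤ (1 / 2 : ℝ) ^ (i + 1) * r := e ▸ hyc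
          _ ≤ _ := by gcongr; linarith
      have h5 := hω0 _ h4
      have h6 := hωmono _ _ h4 h3
      calc _ ≤ C₀ / (r + ‖x - z‖) ^ (2 * n) * ω ((1 / 2) ^ (i + 1)) := by gcongr
        _ = _ := by ring
    calc ‖K x y z - K x c z‖ₑ * (‖a y‖ₑ * ‖h z‖ₑ)
        ≤ (ENNReal.ofReal (C₀ * ω ((1 / 2) ^ (i + 1))) *
          ENNReal.ofReal (((r + ‖x - z‖) ^ (2 * n))⁻¹)) * (‖a y‖ₑ * ‖h z‖ₑ) := by
          rw [← ENNReal.ofReal_mul (by positivity), Real.enorm_eq_ofReal_abs]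
          gcongr
      _ = _ := by ring
  refine (lintegral_mono hpt).trans ?_
  have hm1 : AEMeasurable (fun y => ‖a y‖ₑ) := ha.measurable.enorm.aemeasurable
  have hm2 : AEMeasurable fun y =>
      ‖h y‖ₑ * ENNReal.ofReal (((r + ‖x - y‖) ^ (2 * n))⁻¹) := by
    refine hh.1.enorm.mul (Measurable.aemeasurable ?_)
    fun_prop
  rw [lintegral_const_mul' _ _ ENNReal.ofReal_ne_top, Measure.volume_eq_prod,
    lintegral_prod_mul hm1 hm2]
  gcongr
  exact mul_le_of_le_one_left (zero_le) ha.lintegral_enorm_le_one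

lemma KernelRep2.ae_enorm_le {T : (Rn n → ℝ) → (Rn n → ℝ) → Rn n → ℝ} (hT : KernelRep2 K T)
    (hK : IsCZKernel2 C₀ ω K) (hC₀ : 0 < C₀)
    (hω0 : ∀ t, 0 < t → 0 ≤ ω t) (hωmono : ∀ s t : ℝ, 0 < s → s ≤ t → ω s ≤ ω t)
    (hω : diniSum ω < ∞) {c : Rn n} {l : ℝ} {a h : Rn n → ℝ} (ha : IsCubeAtom c l a)
    (hh : Integrable h) (hh' : HasCompactSupport h) :
    ∀ᵐ x, ∀ i : ℕ, x ∉ cube c (2 ^ (n + 2 + i) * l) → ‖T a h x‖ₑ ≤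
      ENNReal.ofReal (C₀ * ω ((1 / 2) ^ (i + 1))) *
        ∫⁻ y, ‖h y‖ₑ * ENNReal.ofReal (((2 ^ (n + i) * l + ‖x - y‖) ^ (2 * n))⁻¹) := by
  filter_upwards [hT a h ha.integrable hh ha.hasCompactSupport hh'] with x hx i hxi
  rw [hx]
  · exact enorm_integral_kernel_atom_le hK hC₀ hω0 hωmono hω ha hh i hxi
  · refine fun hmem => hxi (cube_mono c ?_ (ha.tsupport_subset hmem.1))
    exact le_mul_of_one_le_left ha.side_pos.le (one_le_pow₀ one_le_two)

end Kernel

/-! ### Commutators with an atom away from its cube -/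

section Tail

variable {n : ℕ} {C₀ M : ℝ} {ω : ℝ → ℝ} {K : Rn n → Rn n → Rn n → ℝ}
  {T : (Rn n → ℝ) → (Rn n → ℝ) → Rn n → ℝ} {b : Rn n → ℝ} {c : Rn n} {l : ℝ}

/-- An integrable majorant, away from the cube of center `c` and side `l`, of the commutator
applied to an atom on this cube. -/
def atomTail (ω : ℝ → ℝ) (b : Rn n → ℝ) (M : ℝ) (c : Rn n) (l : ℝ) (x : Rn n) : ℝ≥0∞ :=
  ∑' i : ℕ, ENNReal.ofReal (ω ((1 / 2) ^ (i + 1)) * ((2 ^ (n + i) * l) ^ n)⁻¹) *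
    (cube c (2 ^ (n + 3 + i) * l)).indicator
      (fun x => ‖b x - avgOn b (cube c l)‖ₑ + ENNReal.ofReal (M * (1 + i))) x

lemma aemeasurable_atomTail_term (hb : LocallyIntegrable b volume) (e s t : ℝ) :
    AEMeasurable ((cube c s).indicator
      (fun x => ‖b x - e‖ₑ + ENNReal.ofReal t)) := by
  refine AEMeasurable.indicator ?_ (measurableSet_cube _ _)
  exact ((hb.aestronglyMeasurable.sub aestronglyMeasurable_const).enorm).add aemeasurable_const

lemma aemeasurable_atomTail (hb : LocallyIntegrable b volume) :
    AEMeasurable (atomTail ω b M c l) :=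
  AEMeasurable.tsum fun _ => (aemeasurable_atomTail_term hb _ _ _).const_mul _

/-- The constant in the bound for the integral of `atomTail`. -/
def tailConst (n : ℕ) (M : ℝ) : ℝ := 8 ^ n * ((n + 4) * 2 ^ n + 1) * M

lemma lintegral_atomTail_le (hω0 : ∀ t, 0 < t → 0 ≤ ω t) (hM : 0 ≤ M)
    (hb : LocallyIntegrable b volume) (hO : OscBound b M) (hl : 0 < l) :
    ∫⁻ x, atomTail ω b M c l x ≤ ENNReal.ofReal (tailConst n M) * diniSum ω := by
  unfold atomTail diniSum
  rw [lintegral_tsum fun i => (aemeasurable_atomTail_term hb _ _ _).const_mul _,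
    ← ENNReal.tsum_mul_left]
  refine ENNReal.tsum_le_tsum fun i => ?_
  have hωi : 0 ≤ ω ((1 / 2) ^ (i + 1)) := hω0 _ (by positivity)
  rw [lintegral_const_mul'' _ (aemeasurable_atomTail_term hb _ _ _),
    lintegral_indicator (measurableSet_cube _ _), lintegral_add_right _ measurable_const,
    setLIntegral_const, volume_cube _ (by positivity)]
  refine (mul_le_mul_right (add_le_add_left (hO.lintegral_cube_le hb c hl (n + 3 + i)) _)
    _).trans ?_
  rw [← ENNReal.ofReal_mul (by positivity), ← ENNReal.ofReal_add (by positivity) (by positivity),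
    ← ENNReal.ofReal_mul (by positivity), ← ENNReal.ofReal_mul (by unfold tailConst; positivity)]
  refine ENNReal.ofReal_le_ofReal ?_
  have e : ((2:ℝ) ^ (n + 3 + i) * l) ^ n = 8 ^ n * (2 ^ (n + i) * l) ^ n := by
    rw [← mul_pow]; congr 1; ring
  have hr : 0 < (2 ^ (n + i) * l) ^ n := by positivity
  rw [e]
  have h1 : (1 + ((n + 3 + i : ℕ) : ℝ) * 2 ^ n) ≤ (n + 4) * 2 ^ n * (1 + i) := by
    have h2 : (1 : ℝ) ≤ 2 ^ n := one_le_pow₀ one_le_two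
    have h3 : (0 : ℝ) ≤ 2 ^ n * ((n + 3) * i) := by positivity
    push_cast
    nlinarith
  calc ω ((1 / 2) ^ (i + 1)) * ((2 ^ (n + i) * l) ^ n)⁻¹ *
        (8 ^ n * (2 ^ (n + i) * l) ^ n * ((1 + ((n + 3 + i : ℕ) : ℝ) * 2 ^ n) * M) +
          M * (1 + i) * (8 ^ n * (2 ^ (n + i) * l) ^ n))
      = ω ((1 / 2) ^ (i + 1)) * 8 ^ n * M * ((1 + ((n + 3 + i : ℕ) : ℝ) * 2 ^ n) + (1 + i)) := by
        field_simp
    _ ≤ ω ((1 / 2) ^ (i + 1)) * 8 ^ n * M * ((n + 4) * 2 ^ n * (1 + i) + (1 + i)) := by gcongr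
    _ = _ := by unfold tailConst; ring

lemma exists_notMem_cube_mem_cube {x : Rn n} (hl : 0 < l) (hx : x ∉ cube c (2 ^ (n + 2) * l)) :
    ∃ i : ℕ, x ∉ cube c (2 ^ (n + 2 + i) * l) ∧ x ∈ cube c (2 ^ (n + 3 + i) * l) := by
  classical
  have hex : ∃ i : ℕ, x ∈ cube c (2 ^ (n + 3 + i) * l) := by
    obtain ⟨p, hp⟩ := exists_mem_cube_two_pow c x hl
    refine ⟨p, cube_mono c ?_ hp⟩
    gcongr
    · norm_num
    · omega
  refine ⟨Nat.find hex, ?_, Nat.find_spec hex⟩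
  rcases hk : Nat.find hex with _ | k
  · simpa using hx
  · have := Nat.find_min hex (m := k) (by omega)
    rwa [show n + 2 + (k + 1) = n + 3 + k by omega]

lemma le_atomTail {x : Rn n} {i : ℕ} (hx : x ∈ cube c (2 ^ (n + 3 + i) * l)) :
    ENNReal.ofReal (ω ((1 / 2) ^ (i + 1)) * ((2 ^ (n + i) * l) ^ n)⁻¹) *
      (‖b x - avgOn b (cube c l)‖ₑ + ENNReal.ofReal (M * (1 + i))) ≤ atomTail ω b M c l x := by
  refine le_trans (le_of_eq ?_) (ENNReal.le_tsum i)
  rw [indicator_of_mem hx]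

lemma lintegral_tail_le_of_notMem_maximalSet (hn : 1 ≤ n) {F : Rn n → ℝ≥0∞} {α r : ℝ}
    (hα : 0 ≤ α) (hr : 0 < r) {h : Rn n → ℝ} (hh : Integrable h) (hhF : ∀ y, ‖h y‖ₑ ≤ F y)
    {x : Rn n} (hx : x ∉ maximalSet F α) :
    ∫⁻ y, ‖h y‖ₑ * ENNReal.ofReal (((r + ‖x - y‖) ^ (2 * n))⁻¹) ≤
      ENNReal.ofReal (4 ^ (n + 1) * α * (r ^ n)⁻¹) := by
  refine lintegral_mul_tail_le hn hh.1.enorm hr hα fun i => ?_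
  refine (lintegral_mono hhF).trans
    ((lintegral_closedBall_le_of_notMem_maximalSet hx (by positivity)).trans ?_)
  refine ENNReal.ofReal_le_ofReal ?_
  have : α ≤ α * (1 + i) := le_mul_of_one_le_right hα (by simp)
  gcongr

lemma lintegral_sub_avgOn_mul_tail_le (hn : 1 ≤ n) (hM : 0 ≤ M)
    (hb : LocallyIntegrable b volume) (hO : OscBound b M) (hl : 0 < l) {g : Rn n → ℝ}
    (hg : Measurable g) {B : ℝ} (hB : ∀ y, |g y| ≤ B) {i : ℕ} {x : Rn n}
    (hx : x ∈ cube c (2 ^ (n + 3 + i) * l)) :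
    ∫⁻ y, ‖(b y - avgOn b (cube c l)) * g y‖ₑ *
        ENNReal.ofReal (((2 ^ (n + i) * l + ‖x - y‖) ^ (2 * n))⁻¹) ≤
      ENNReal.ofReal (4 ^ (n + 1) * (B * (32 ^ n * (n + 5) * (1 + i) * M)) *
        ((2 ^ (n + i) * l) ^ n)⁻¹) := by
  have hB0 : 0 ≤ B := (abs_nonneg _).trans (hB 0)
  refine lintegral_mul_tail_le hn ?_ (by positivity) (by positivity) fun j => ?_
  · exact ((hb.aestronglyMeasurable.sub aestronglyMeasurable_const).mul
      hg.aestronglyMeasurable).enorm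
  set r := 2 ^ (n + i) * l with hr
  have hr0 : 0 < r := by positivity
  have hsub : Metric.closedBall x (2 ^ j * r) ⊆ cube c (2 ^ (n + i + j + 4) * l) := by
    intro y hy
    rw [mem_closedBall_iff_norm] at hy
    refine cube_mono c ?_ (mem_cube_of_norm_sub_le hx hy)
    have e1 : (2:ℝ) ^ (n + 3 + i) * l = 8 * r := by rw [hr]; ring
    have e2 : (2:ℝ) ^ (n + i + j + 4) * l = 16 * (2 ^ j * r) := by rw [hr]; ring
    have h2 : r ≤ 2 ^ j * r := le_mul_of_one_le_left hr0.le (one_le_pow₀ one_le_two)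
    rw [e1, e2]
    linarith
  calc ∫⁻ y in Metric.closedBall x (2 ^ j * r), ‖(b y - avgOn b (cube c l)) * g y‖ₑ
      ≤ ∫⁻ y in cube c (2 ^ (n + i + j + 4) * l),
          ENNReal.ofReal B * ‖b y - avgOn b (cube c l)‖ₑ := by
        refine (lintegral_mono_set hsub).trans (lintegral_mono fun y => ?_)
        rw [enorm_mul, mul_comm, Real.enorm_eq_ofReal_abs (g y)]
        gcongr
        exact hB y
    _ ≤ ENNReal.ofReal B * ENNReal.ofReal ((2 ^ (n + i + j + 4) * l) ^ n *
          ((1 + ((n + i + j + 4 : ℕ) : ℝ) * 2 ^ n) * M)) := by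
        rw [lintegral_const_mul' _ _ ENNReal.ofReal_ne_top]
        gcongr
        exact hO.lintegral_cube_le hb c hl _
    _ ≤ _ := by
        rw [← ENNReal.ofReal_mul hB0]
        refine ENNReal.ofReal_le_ofReal ?_
        have e : ((2:ℝ) ^ (n + i + j + 4) * l) ^ n = 16 ^ n * (2 ^ j * r) ^ n := by
          rw [← mul_pow, hr]; congr 1; ring
        have h1 : (1 + ((n + i + j + 4 : ℕ) : ℝ) * 2 ^ n) ≤
            2 ^ n * ((n + 5) * (1 + i) * (1 + j)) := by
          have h2 : (1 : ℝ) ≤ 2 ^ n := one_le_pow₀ one_le_two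
          have h3 : (n : ℝ) + i + j + 5 ≤ (n + 5) * (1 + i) * (1 + j) := by
            have : (0 : ℝ) ≤ n * i + n * j + n * i * j + 4 * i + 4 * j + 5 * i * j := by
              positivity
            linarith
          have h4 := mul_le_mul_of_nonneg_left h3 (zero_le_one.trans h2)
          push_cast
          linarith
        rw [e]
        calc B * (16 ^ n * (2 ^ j * r) ^ n * ((1 + ((n + i + j + 4 : ℕ) : ℝ) * 2 ^ n) * M))
            ≤ B * (16 ^ n * (2 ^ j * r) ^ n *
                ((2 ^ n * ((n + 5) * (1 + i) * (1 + j))) * M)) := by gcongr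
          _ = B * ((16 * 2) ^ n * (n + 5) * (1 + i) * M) * (1 + j) * (2 ^ j * r) ^ n := by
              rw [mul_pow 16 2]; ring
          _ = _ := by norm_num

lemma ae_enorm_mul_atom_le (hn : 1 ≤ n) (hω0 : ∀ t, 0 < t → 0 ≤ ω t)
    (hωmono : ∀ s t : ℝ, 0 < s → s ≤ t → ω s ≤ ω t) (hω : diniSum ω < ∞)
    (hK : IsCZKernel2 C₀ ω K) (hT : KernelRep2 K T) (hC₀ : 0 < C₀)
    {a h : Rn n → ℝ} (ha : IsCubeAtom c l a) (hh : Integrable h)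
    (hh' : HasCompactSupport h) {F : Rn n → ℝ≥0∞} (hhF : ∀ y, ‖h y‖ₑ ≤ F y) {α : ℝ}
    (hα : 0 ≤ α) :
    ∀ᵐ x, x ∉ maximalSet F α → x ∉ cube c (2 ^ (n + 2) * l) →
      ‖(b x - avgOn b (cube c l)) * T a h x‖ₑ ≤
        ENNReal.ofReal (C₀ * (4 ^ (n + 1) * α)) * atomTail ω b M c l x := by
  filter_upwards [hT.ae_enorm_le hK hC₀ hω0 hωmono hω ha hh hh'] with x hx hxF hxc
  have hl := ha.side_pos
  obtain ⟨i, hi, hi'⟩ := exists_notMem_cube_mem_cube hl hxc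
  have hωi : 0 ≤ ω ((1 / 2) ^ (i + 1)) := hω0 _ (by positivity)
  have h1 := (hx i hi).trans (mul_le_mul_right
    (lintegral_tail_le_of_notMem_maximalSet hn hα (by positivity) hh hhF hxF) _)
  refine le_trans ?_ (mul_le_mul_right (le_atomTail hi') _)
  rw [enorm_mul]
  calc ‖b x - avgOn b (cube c l)‖ₑ * ‖T a h x‖ₑ
      ≤ ‖b x - avgOn b (cube c l)‖ₑ * (ENNReal.ofReal (C₀ * ω ((1 / 2) ^ (i + 1))) *
          ENNReal.ofReal (4 ^ (n + 1) * α * ((2 ^ (n + i) * l) ^ n)⁻¹)) := by gcongr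
    _ = ENNReal.ofReal (C₀ * (4 ^ (n + 1) * α)) *
          (ENNReal.ofReal (ω ((1 / 2) ^ (i + 1)) * ((2 ^ (n + i) * l) ^ n)⁻¹) *
            ‖b x - avgOn b (cube c l)‖ₑ) := by
        rw [← ENNReal.ofReal_mul (by positivity), ← mul_assoc (ENNReal.ofReal _),
          ← ENNReal.ofReal_mul (by positivity), mul_comm]
        congr 2
        ring
    _ ≤ _ := by
        gcongr
        exact le_self_add

lemma ae_enorm_commutator_atom_le (hn : 1 ≤ n) (hω0 : ∀ t, 0 < t → 0 ≤ ω t)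
    (hωmono : ∀ s t : ℝ, 0 < s → s ≤ t → ω s ≤ ω t) (hω : diniSum ω < ∞)
    (hK : IsCZKernel2 C₀ ω K) (hT : KernelRep2 K T) (hC₀ : 0 < C₀)
    (hM : 0 ≤ M) (hb : LocallyIntegrable b volume)
    (hO : OscBound b M) {a g : Rn n → ℝ} (ha : IsCubeAtom c l a) (hg : Measurable g)
    (hgi : Integrable g) (hg' : HasCompactSupport g) {F : Rn n → ℝ≥0∞}
    (hgF : ∀ y, ‖g y‖ₑ ≤ F y) {α B : ℝ} (hα : 0 ≤ α) (hB : ∀ y, |g y| ≤ B) :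
    ∀ᵐ x, x ∉ maximalSet F α → x ∉ cube c (2 ^ (n + 2) * l) →
      ‖(b x - avgOn b (cube c l)) * T a g x -
          T a (fun y => (b y - avgOn b (cube c l)) * g y) x‖ₑ ≤
        ENNReal.ofReal (C₀ * (4 ^ (n + 1) * (α + B * (32 ^ n * (n + 5))))) *
          atomTail ω b M c l x := by
  have hl := ha.side_pos
  have hB0 : 0 ≤ B := (abs_nonneg _).trans (hB 0)
  filter_upwards [hT.ae_enorm_le hK hC₀ hω0 hωmono hω ha hgi hg',
    hT.ae_enorm_le hK hC₀ hω0 hωmono hω ha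
      (integrable_sub_const_mul hb hg hB hg' (avgOn b (cube c l))) hg'.mul_left]
    with x hx hx' hxF hxc
  obtain ⟨i, hi, hi'⟩ := exists_notMem_cube_mem_cube hl hxc
  have hωi : 0 ≤ ω ((1 / 2) ^ (i + 1)) := hω0 _ (by positivity)
  have h1 := (hx i hi).trans (mul_le_mul_right
    (lintegral_tail_le_of_notMem_maximalSet hn hα (by positivity) hgi hgF hxF) _)
  have h2 := (hx' i hi).trans (mul_le_mul_right
    (lintegral_sub_avgOn_mul_tail_le hn hM hb hO hl hg hB hi') _)
  refine le_trans ?_ (mul_le_mul_right (le_atomTail hi') _)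
  refine (enorm_sub_le).trans ?_
  rw [enorm_mul]
  set D := ‖b x - avgOn b (cube c l)‖ₑ
  set w := ENNReal.ofReal (ω ((1 / 2) ^ (i + 1)) * ((2 ^ (n + i) * l) ^ n)⁻¹) with hw
  calc D * ‖T a g x‖ₑ + ‖T a (fun y => (b y - avgOn b (cube c l)) * g y) x‖ₑ
      ≤ D * (ENNReal.ofReal (C₀ * ω ((1 / 2) ^ (i + 1))) *
          ENNReal.ofReal (4 ^ (n + 1) * α * ((2 ^ (n + i) * l) ^ n)⁻¹)) +
        ENNReal.ofReal (C₀ * ω ((1 / 2) ^ (i + 1))) *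
          ENNReal.ofReal (4 ^ (n + 1) * (B * (32 ^ n * (n + 5) * (1 + i) * M)) *
            ((2 ^ (n + i) * l) ^ n)⁻¹) := by gcongr
    _ = ENNReal.ofReal (C₀ * (4 ^ (n + 1) * α)) * (w * D) +
        ENNReal.ofReal (C₀ * (4 ^ (n + 1) * (B * (32 ^ n * (n + 5))))) *
          (w * ENNReal.ofReal (M * (1 + i))) := by
        rw [hw]
        congr 1
        · rw [← ENNReal.ofReal_mul (by positivity), ← mul_assoc (ENNReal.ofReal _),
            ← ENNReal.ofReal_mul (by positivity), mul_comm]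
          congr 2
          ring
        · rw [← ENNReal.ofReal_mul (by positivity), ← ENNReal.ofReal_mul (by positivity),
            ← ENNReal.ofReal_mul (by positivity)]
          congr 1
          ring
    _ ≤ ENNReal.ofReal (C₀ * (4 ^ (n + 1) * (α + B * (32 ^ n * (n + 5))))) * (w * D) +
        ENNReal.ofReal (C₀ * (4 ^ (n + 1) * (α + B * (32 ^ n * (n + 5))))) *
          (w * ENNReal.ofReal (M * (1 + i))) := by
        gcongr
        · exact le_add_of_nonneg_right (by positivity)
        · exact le_add_of_nonneg_left hα
    _ = _ := by ring

end Tail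

/-! ### The Calderón–Zygmund decomposition of a finite atomic sum -/

section Decomposition

variable {n : ℕ} {ι : Type*}

/-- The size function `∑ |μ_k| |Q_k|⁻¹ 1_{Q_k}` of an atomic sum. -/
def atomicDensity (s : Finset ι) (Q : ι → Set (Rn n)) (l μ : ι → ℝ) (x : Rn n) : ℝ≥0∞ :=
  ∑ k ∈ s, ‖μ k‖ₑ * (Q k).indicator (fun _ => ENNReal.ofReal ((l k ^ n)⁻¹)) x

lemma lintegral_atomicDensity_le {s : Finset ι} {Q : ι → Set (Rn n)} {c : ι → Rn n} {l μ : ι → ℝ}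
    (hQ : ∀ k, IsCubeLike (Q k) (c k) (l k)) (hμ : ∑ k ∈ s, |μ k| ≤ 1) :
    ∫⁻ x, atomicDensity s Q l μ x ≤ 1 := by
  unfold atomicDensity
  rw [lintegral_finsetSum' _ fun k _ => ((measurable_const.indicator
    (hQ k).measurable).const_mul _).aemeasurable]
  have : ∀ k ∈ s, ∫⁻ x, ‖μ k‖ₑ *
      (Q k).indicator (fun _ => ENNReal.ofReal ((l k ^ n)⁻¹)) x = ENNReal.ofReal |μ k| := by
    intro k _
    have hl := pow_pos (hQ k).side_pos n
    rw [lintegral_const_mul' _ _ (by simp), lintegral_indicator (hQ k).measurable,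
      setLIntegral_const, (hQ k).volume_eq, ← ENNReal.ofReal_mul (by positivity),
      inv_mul_cancel₀ hl.ne', ENNReal.ofReal_one, mul_one, Real.enorm_eq_ofReal_abs]
  rw [Finset.sum_congr rfl this, ← ENNReal.ofReal_sum_of_nonneg fun _ _ => abs_nonneg _]
  exact ENNReal.ofReal_le_one.2 hμ

lemma enorm_sum_le_atomicDensity {s t : Finset ι} (hts : t ⊆ s) {Q : ι → Set (Rn n)}
    {l μ : ι → ℝ} {a : ι → Rn n → ℝ} (ha : ∀ k x, x ∉ Q k → a k x = 0)
    (ha' : ∀ k x, |a k x| ≤ (l k ^ n)⁻¹) (x : Rn n) :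
    ‖∑ k ∈ t, μ k * a k x‖ₑ ≤ atomicDensity s Q l μ x := by
  refine (enorm_sum_le _ _).trans ((Finset.sum_le_sum fun k _ => ?_).trans
    (Finset.sum_le_sum_of_subset hts))
  rw [enorm_mul]
  gcongr
  by_cases hx : x ∈ Q k
  · rw [indicator_of_mem hx, Real.enorm_eq_ofReal_abs]
    exact ENNReal.ofReal_le_ofReal (ha' k x)
  · simp [ha k x hx]

/-- The constant in the bound for the good part of an atomic sum. -/
def goodConst (n : ℕ) : ℝ := (2 ^ (2 * n + 2)) ^ n

lemma atomicDensity_le_of_notMem_maximalSet (hn : n ≠ 0) {s t : Finset ι} (hts : t ⊆ s)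
    {Q : ι → Set (Rn n)} {c : ι → Rn n} {l μ : ι → ℝ} (hQ : ∀ k, IsCubeLike (Q k) (c k) (l k))
    (hQ' : ∀ k, IsDyadicCube (Q k)) {α : ℝ} (hα : 0 < α)
    (ht : ∀ k ∈ t, ∃ z ∈ cube (c k) (2 ^ (n + 2) * l k),
      z ∉ maximalSet (atomicDensity s Q l μ) α) (x : Rn n) :
    atomicDensity t Q l μ x ≤ ENNReal.ofReal (goodConst n * α) := by
  classical
  set t' := t.filter fun k => x ∈ Q k with ht'
  have hsum : atomicDensity t Q l μ x = ∑ k ∈ t', ‖μ k‖ₑ * ENNReal.ofReal ((l k ^ n)⁻¹) := by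
    rw [ht', Finset.sum_filter, atomicDensity]
    refine Finset.sum_congr rfl fun k _ => ?_
    by_cases hx : x ∈ Q k <;> simp [hx]
  rcases t'.eq_empty_or_nonempty with he | hne
  · rw [hsum, he]; simp
  obtain ⟨j, hj, hmin⟩ := t'.exists_min_image l hne
  have hjt := (Finset.mem_filter.1 hj)
  obtain ⟨z, hz, hzF⟩ := ht j hjt.1
  have hl := (hQ j).side_pos
  have hball : Q j ⊆ Metric.closedBall z (2 ^ (2 * n + 2) * l j) := by
    intro y hy
    have h1 := norm_sub_le_of_mem_cube hl.le ((hQ j).subset hy)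
    have h2 := norm_sub_le_of_mem_cube (by positivity) hz
    rw [Metric.mem_closedBall, dist_eq_norm]
    have h3 : ‖y - z‖ ≤ ‖y - c j‖ + ‖z - c j‖ := by
      simpa using norm_sub_le (y - c j) (z - c j)
    refine (h3.trans (add_le_add h1 h2)).trans ?_
    have h4 : (1:ℝ) ≤ 2 ^ n := one_le_pow₀ one_le_two
    have h5 : (2:ℝ) ^ n ≤ 2 ^ n * 2 ^ n := le_mul_of_one_le_right (by positivity) h4
    have : (2:ℝ) ^ n * (l j / 2) + 2 ^ n * (2 ^ (n + 2) * l j / 2) =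
        (2 ^ n / 2 + 2 * (2 ^ n * 2 ^ n)) * l j := by ring
    rw [this]
    refine mul_le_mul_of_nonneg_right ?_ hl.le
    have : (2:ℝ) ^ (2 * n + 2) = 4 * (2 ^ n * 2 ^ n) := by ring
    rw [this]
    linarith
  have hle : ∀ y ∈ Q j, atomicDensity t Q l μ x ≤ atomicDensity s Q l μ y := by
    intro y hy
    rw [hsum, atomicDensity]
    refine le_trans (Finset.sum_le_sum fun k hk => ?_)
      (Finset.sum_le_sum_of_subset ((Finset.filter_subset _ t).trans hts))
    have hxk := (Finset.mem_filter.1 hk).2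
    rw [indicator_of_mem]
    exact (hQ' j).subset_of_volume_le hn (hQ' k) hjt.2 hxk (hQ j) (hQ k) (hmin k hk) hy
  have hln := pow_pos hl n
  have key : atomicDensity t Q l μ x * ENNReal.ofReal (l j ^ n) ≤
      ENNReal.ofReal (goodConst n * α) * ENNReal.ofReal (l j ^ n) := by
    rw [← (hQ j).volume_eq, ← setLIntegral_const]
    refine (setLIntegral_mono' (hQ j).measurable hle).trans
      ((lintegral_mono_set hball).trans
        ((lintegral_closedBall_le_of_notMem_maximalSet hzF (by positivity)).trans (le_of_eq ?_)))
    rw [(hQ j).volume_eq, ← ENNReal.ofReal_mul (by unfold goodConst; positivity), goodConst,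
      mul_pow]
    congr 1
    ring
  exact (ENNReal.mul_le_mul_iff_left (by simpa using hln) ENNReal.ofReal_ne_top).1 key

/-- `g + ∑ₖ μₖ aₖ` splits an atomic sum of size at most `F` into a bounded part `g` and
atoms whose cubes lie deep inside the set where the maximal function of `F` exceeds `α`. -/
structure IsDecomposition (α : ℝ) (F : Rn n → ℝ≥0∞) (g : Rn n → ℝ) (s : Finset ι)
    (c : ι → Rn n) (l μ : ι → ℝ) (a : ι → Rn n → ℝ) : Prop where
  lintegral_le : ∫⁻ x, F x ≤ 1
  atom : ∀ k, IsCubeAtom (c k) (l k) (a k)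
  sum_abs_le : ∑ k ∈ s, |μ k| ≤ 1
  subset_maximalSet : ∀ k ∈ s, cube (c k) (2 ^ (n + 2) * l k) ⊆ maximalSet F α
  measurable : Measurable g
  hasCompactSupport : HasCompactSupport g
  abs_le : ∀ x, |g x| ≤ goodConst n * α
  enorm_le : ∀ x, ‖g x‖ₑ ≤ F x
  enorm_add_le : ∀ x, ‖g x + ∑ k ∈ s, μ k * a k x‖ₑ ≤ F x

lemma IsH1Atom.exists_isCubeAtom {Q : Set (Rn n)} {c : Rn n} {l : ℝ} (hQ : IsCubeLike Q c l)
    {a : Rn n → ℝ} (ha : IsH1Atom Q a) :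
    ∃ a', IsCubeAtom c l a' ∧ (∀ x, x ∉ Q → a' x = 0) ∧ a' =ᵐ[volume] a := by
  obtain ⟨hm, h0, hle, hint⟩ := ha
  have hl := pow_pos hQ.side_pos n
  have hvol : (volume Q).toReal = l ^ n := by
    rw [hQ.volume_eq, ENNReal.toReal_ofReal hl.le]
  rw [hvol] at hle
  set S := {x | |a x| ≤ (l ^ n)⁻¹} with hS
  have hSm : MeasurableSet S := measurableSet_le hm.abs measurable_const
  have hae : S.indicator a =ᵐ[volume] a := by
    filter_upwards [hle] with x hx
    exact indicator_of_mem (s := S) hx a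
  have hQ0 : ∀ x, x ∉ Q → S.indicator a x = 0 := fun x hx => by
    simp [indicator_apply, h0 x hx]
  refine ⟨S.indicator a, ⟨hQ.side_pos, hm.indicator hSm, fun x hx => hQ0 x fun h =>
    hx (hQ.subset h), fun x => ?_, by rw [integral_congr_ae hae, hint]⟩, hQ0, hae⟩
  by_cases hx : x ∈ S
  · rw [indicator_of_mem hx]; exact hx
  · rw [indicator_of_notMem hx, abs_zero]; positivity

lemma hasCompactSupport_sum {s : Finset ι} {μ : ι → ℝ} {a : ι → Rn n → ℝ}
    (ha : ∀ k ∈ s, HasCompactSupport (a k)) :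
    HasCompactSupport fun x => ∑ k ∈ s, μ k * a k x := by
  refine HasCompactSupport.intro (s.isCompact_biUnion fun k hk => ha k hk) fun x hx => ?_
  simp only [mem_iUnion, not_exists] at hx
  refine Finset.sum_eq_zero fun k hk => ?_
  rw [image_eq_zero_of_notMem_tsupport (hx k hk), mul_zero]

lemma FiniteAtomicSum.exists_isDecomposition (hn : n ≠ 0) {f : Rn n → ℝ} (hf : FiniteAtomicSum f)
    {α : ℝ} (hα : 0 < α) :
    ∃ (F : Rn n → ℝ≥0∞) (g : Rn n → ℝ) (N : ℕ) (s : Finset (Fin N)) (c : Fin N → Rn n)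
      (l μ : Fin N → ℝ) (a : Fin N → Rn n → ℝ), IsDecomposition α F g s c l μ a ∧
        f =ᵐ[volume] fun x => g x + ∑ k ∈ s, μ k * a k x := by
  classical
  obtain ⟨N, Q, a₀, μ, hQ, ha₀, hμ, hf⟩ := hf
  choose c l hcl using fun k => (hQ k).exists_isCubeLike
  choose a ha haQ hae using fun k => (ha₀ k).exists_isCubeAtom (hcl k)
  set F := atomicDensity Finset.univ Q l μ with hF
  set s : Finset (Fin N) := Finset.univ.filter fun k =>
    cube (c k) (2 ^ (n + 2) * l k) ⊆ maximalSet F α with hs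
  have hgood : ∀ x, ‖∑ k ∈ sᶜ, μ k * a k x‖ₑ ≤ ENNReal.ofReal (goodConst n * α) := fun x => by
    refine (enorm_sum_le_atomicDensity subset_rfl haQ (fun k => (ha k).abs_le) x).trans
      (atomicDensity_le_of_notMem_maximalSet hn (Finset.subset_univ _) hcl hQ hα ?_ x)
    intro k hk
    simpa [hs, not_subset] using hk
  have hle := fun t x => enorm_sum_le_atomicDensity (μ := μ) (Finset.subset_univ t) haQ
    (fun k => (ha k).abs_le) x
  have hsplit : ∀ x, ∑ k ∈ sᶜ, μ k * a k x + ∑ k ∈ s, μ k * a k x = ∑ k, μ k * a k x :=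
    fun x => Finset.sum_compl_add_sum s _
  refine ⟨F, fun x => ∑ k ∈ sᶜ, μ k * a k x, N, s, c, l, μ, a,
    ⟨lintegral_atomicDensity_le hcl hμ, ha, ?_, ?_, ?_, ?_, ?_, hle _, ?_⟩, ?_⟩
  · exact (Finset.sum_le_sum_of_subset_of_nonneg (Finset.subset_univ s)
      fun _ _ _ => abs_nonneg _).trans hμ
  · intro k hk
    exact (Finset.mem_filter.1 hk).2
  · exact Finset.measurable_fun_sum _ fun k _ => (ha k).measurable.const_mul _
  · exact hasCompactSupport_sum fun k _ => (ha k).hasCompactSupport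
  · intro x
    have := hgood x
    rwa [Real.enorm_eq_ofReal_abs, ENNReal.ofReal_le_ofReal_iff
      (by unfold goodConst; positivity)] at this
  · intro x
    rw [hsplit]
    exact hle _ x
  · filter_upwards [ae_all_iff.2 hae] with x hx
    rw [hsplit, hf x]
    simp only [hx]

end Decomposition

/-! ### Linearity of the bilinear operator -/

section Linear

variable {n : ℕ} {ι : Type*} {T : (Rn n → ℝ) → (Rn n → ℝ) → Rn n → ℝ} {b f g h : Rn n → ℝ}

lemma Bilin2.swap (hB : Bilin2 T) : Bilin2 fun f g => T g f :=
  ⟨fun f f' g hf hf' hg => hB.2.2.1 g f f' hg hf hf', fun r f g hf hg => hB.2.2.2 r g f hg hf,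
    fun f g g' hf hg hg' => hB.1 g g' f hg hg' hf, fun r f g hf hg => hB.2.1 r g f hg hf⟩

lemma Bilin2.sum_left (hB : Bilin2 T) (s : Finset ι) {f : ι → Rn n → ℝ} (μ : ι → ℝ)
    (hf : ∀ k ∈ s, Integrable (f k)) (hg : Integrable g) (x : Rn n) :
    T (fun y => ∑ k ∈ s, μ k * f k y) g x = ∑ k ∈ s, μ k * T (f k) g x := by
  classical
  induction s using Finset.induction_on with
  | empty => simpa using hB.2.1 0 (fun _ => 0) g (integrable_zero _ _ _) hg x
  | insert j s hj ih =>
    have hfs : ∀ k ∈ s, Integrable (f k) := fun k hk => hf k (Finset.mem_insert_of_mem hk)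
    have hfj := hf j (Finset.mem_insert_self j s)
    simp only [Finset.sum_insert hj]
    rw [hB.1 _ _ g (hfj.const_mul _) (integrable_finsetSum s fun k hk => (hfs k hk).const_mul _)
      hg, ih hfs, hB.2.1 _ _ g hfj hg]

lemma Bilin2.sub_left (hB : Bilin2 T) (hf : Integrable f) (hg : Integrable g) (hh : Integrable h)
    (x : Rn n) : T (fun y => f y - g y) h x = T f h x - T g h x := by
  have h1 := hB.1 f (fun y => -1 * g y) h hf (hg.const_mul _) hh x
  rw [hB.2.1 _ g h hg hh] at h1
  simpa [sub_eq_add_neg] using h1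

lemma Bilin2.commutator_sub_const (hB : Bilin2 T) (hf : Integrable f)
    (hbf : Integrable fun y => b y * f y) (hg : Integrable g) (e : ℝ) (x : Rn n) :
    b x * T f g x - T (fun y => b y * f y) g x =
      (b x - e) * T f g x - T (fun y => (b y - e) * f y) g x := by
  have h1 := hB.sub_left hbf (hf.const_mul e) hg x
  simp only [← sub_mul] at h1
  rw [h1, hB.2.1 e f g hf hg]
  ring

lemma ae_eq_zero_of_l1norm_eq_zero {C : ℝ}
    (hw : ∀ f g : Rn n → ℝ, Integrable f → Integrable g → ∀ lam : ℝ, 0 < lam →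
      volume {x | lam < |T f g x|} ≤
        ENNReal.ofReal ((C * l1norm f * l1norm g / lam) ^ ((1:ℝ)/2)))
    (hf : Integrable f) (hg : Integrable g) (h0 : l1norm f = 0 ∨ l1norm g = 0) :
    ∀ᵐ x, T f g x = 0 := by
  have h1 : ∀ k : ℕ, ∀ᵐ x, |T f g x| ≤ 1 / ((k : ℝ) + 1) := fun k => by
    have := hw f g hf hg (1 / ((k : ℝ) + 1)) (by positivity)
    have h2 : C * l1norm f * l1norm g = 0 := by rcases h0 with h | h <;> simp [h]
    rw [h2, zero_div, Real.zero_rpow (by norm_num), ENNReal.ofReal_zero, nonpos_iff_eq_zero] at this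
    rw [ae_iff]
    simpa using this
  filter_upwards [ae_all_iff.2 h1] with x hx
  exact abs_nonpos_iff.1 (ge_of_tendsto' tendsto_one_div_add_atTop_nhds_zero_nat hx)

lemma Bilin2.congr_ae (hB : Bilin2 T) {C : ℝ}
    (hw : ∀ f g : Rn n → ℝ, Integrable f → Integrable g → ∀ lam : ℝ, 0 < lam →
      volume {x | lam < |T f g x|} ≤
        ENNReal.ofReal ((C * l1norm f * l1norm g / lam) ^ ((1:ℝ)/2)))
    {f' g' : Rn n → ℝ} (hf : Integrable f) (hg : Integrable g) (hff : f =ᵐ[volume] f')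
    (hgg : g =ᵐ[volume] g') : T f g =ᵐ[volume] T f' g' := by
  have hf' := hf.congr hff
  have hg' := hg.congr hgg
  have key : ∀ {f f' : Rn n → ℝ}, f =ᵐ[volume] f' → l1norm (fun y => f y - f' y) = 0 := by
    intro f f' h
    refine integral_eq_zero_of_ae ?_
    filter_upwards [h] with x hx
    simp [hx]
  filter_upwards [ae_eq_zero_of_l1norm_eq_zero hw (hf.sub hf') hg (Or.inl (key hff)),
    ae_eq_zero_of_l1norm_eq_zero hw hf' (hg.sub hg') (Or.inr (key hgg))] with x h1 h2
  have e1 := hB.sub_left hf hf' hg x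
  have e2 := hB.swap.sub_left hg hg' hf' x
  simp only [Pi.sub_def] at h1 h2
  linarith

end Linear

/-! ### The weak type estimate -/

section Main

variable {n : ℕ} {ι κ : Type*} {T : (Rn n → ℝ) → (Rn n → ℝ) → Rn n → ℝ} {b : Rn n → ℝ}
  {α M : ℝ} {F : Rn n → ℝ≥0∞} {g : Rn n → ℝ} {s : Finset ι} {c : ι → Rn n} {l μ : ι → ℝ}
  {a : ι → Rn n → ℝ}

lemma goodConst_pos (n : ℕ) : 0 < goodConst n := by
  unfold goodConst; positivity

namespace IsDecomposition

lemma integrable (h : IsDecomposition α F g s c l μ a) : Integrable g :=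
  ⟨h.measurable.aestronglyMeasurable,
    ((lintegral_mono h.enorm_le).trans h.lintegral_le).trans_lt ENNReal.one_lt_top⟩

lemma hasCompactSupport_add (h : IsDecomposition α F g s c l μ a) :
    HasCompactSupport fun x => g x + ∑ k ∈ s, μ k * a k x :=
  h.hasCompactSupport.add (hasCompactSupport_sum fun k _ => (h.atom k).hasCompactSupport)

lemma integrable_sum (h : IsDecomposition α F g s c l μ a) :
    Integrable fun x => ∑ k ∈ s, μ k * a k x :=
  integrable_finsetSum s fun k _ => (h.atom k).integrable.const_mul _

lemma integrable_add (h : IsDecomposition α F g s c l μ a) :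
    Integrable fun x => g x + ∑ k ∈ s, μ k * a k x :=
  h.integrable.add h.integrable_sum

lemma l1norm_add_le (h : IsDecomposition α F g s c l μ a) :
    l1norm (fun x => g x + ∑ k ∈ s, μ k * a k x) ≤ 1 := by
  unfold l1norm
  simp only [← Real.norm_eq_abs]
  rw [integral_norm_eq_lintegral_enorm h.integrable_add.1]
  refine ENNReal.toReal_le_of_le_ofReal zero_le_one ?_
  rw [ENNReal.ofReal_one]
  exact (lintegral_mono h.enorm_add_le).trans h.lintegral_le

lemma l2norm_le (h : IsDecomposition α F g s c l μ a) (hα : 0 < α) :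
    l2norm g ≤ (goodConst n * α) ^ ((1:ℝ)/2) := by
  have hκ := goodConst_pos n
  have hsq : ∀ x, ‖g x ^ 2‖ₑ ≤ ENNReal.ofReal (goodConst n * α) * F x := fun x => by
    rw [sq, enorm_mul]
    refine mul_le_mul' ?_ (h.enorm_le x)
    rw [Real.enorm_eq_ofReal_abs]
    exact ENNReal.ofReal_le_ofReal (h.abs_le x)
  refine Real.rpow_le_rpow (integral_nonneg fun x => sq_nonneg _) ?_ (by norm_num)
  rw [integral_congr_ae (ae_of_all _ fun x => (Real.norm_of_nonneg (sq_nonneg (g x))).symm),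
    integral_norm_eq_lintegral_enorm (h.measurable.pow_const 2).aestronglyMeasurable]
  refine ENNReal.toReal_le_of_le_ofReal (by positivity) ?_
  refine (lintegral_mono hsq).trans ?_
  rw [lintegral_const_mul' _ _ ENNReal.ofReal_ne_top]
  exact mul_le_of_le_one_right' h.lintegral_le

lemma l1norm_sum_le (h : IsDecomposition α F g s c l μ a) (hM : 0 ≤ M)
    (hb : LocallyIntegrable b volume) (hO : OscBound b M) :
    l1norm (fun x => ∑ k ∈ s, μ k * ((b x - avgOn b (cube (c k) (l k))) * a k x)) ≤ M := by
  have hint : ∀ k ∈ s, Integrable fun x =>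
      μ k * ((b x - avgOn b (cube (c k) (l k))) * a k x) :=
    fun k _ => ((h.atom k).integrable_mul hb _).const_mul _
  unfold l1norm
  simp only [← Real.norm_eq_abs]
  rw [integral_norm_eq_lintegral_enorm (integrable_finsetSum s hint).1]
  refine ENNReal.toReal_le_of_le_ofReal hM ?_
  calc ∫⁻ x, ‖∑ k ∈ s, μ k * ((b x - avgOn b (cube (c k) (l k))) * a k x)‖ₑ
      ≤ ∫⁻ x, ∑ k ∈ s, ‖μ k * ((b x - avgOn b (cube (c k) (l k))) * a k x)‖ₑ :=
        lintegral_mono fun x => enorm_sum_le _ _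
    _ = ∑ k ∈ s, ∫⁻ x, ‖μ k * ((b x - avgOn b (cube (c k) (l k))) * a k x)‖ₑ :=
        lintegral_finsetSum' _ fun k hk => (hint k hk).1.enorm
    _ ≤ ∑ k ∈ s, ENNReal.ofReal |μ k| * ENNReal.ofReal M := by
        refine Finset.sum_le_sum fun k _ => ?_
        simp only [enorm_mul (μ k)]
        rw [lintegral_const_mul' _ _ (by simp), Real.enorm_eq_ofReal_abs]
        gcongr
        exact (h.atom k).lintegral_mul_le hb hO
    _ ≤ ENNReal.ofReal M := by
        rw [← Finset.sum_mul, ← ENNReal.ofReal_sum_of_nonneg fun _ _ => abs_nonneg _]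
        exact mul_le_of_le_one_left' (ENNReal.ofReal_le_one.2 h.sum_abs_le)

lemma lintegral_sum_atomTail_le {ω : ℝ → ℝ} (h : IsDecomposition α F g s c l μ a)
    (hω0 : ∀ t, 0 < t → 0 ≤ ω t) (hM : 0 ≤ M) (hb : LocallyIntegrable b volume)
    (hO : OscBound b M) :
    ∫⁻ x, ∑ k ∈ s, ‖μ k‖ₑ * atomTail ω b M (c k) (l k) x ≤
      ENNReal.ofReal (tailConst n M) * diniSum ω := by
  rw [lintegral_finsetSum' _ fun k _ => (aemeasurable_atomTail hb).const_mul _]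
  calc ∑ k ∈ s, ∫⁻ x, ‖μ k‖ₑ * atomTail ω b M (c k) (l k) x
      ≤ ∑ k ∈ s, ENNReal.ofReal |μ k| * (ENNReal.ofReal (tailConst n M) * diniSum ω) := by
        refine Finset.sum_le_sum fun k _ => ?_
        rw [lintegral_const_mul' _ _ (by simp), Real.enorm_eq_ofReal_abs]
        gcongr
        exact lintegral_atomTail_le hω0 hM hb hO (h.atom k).side_pos
    _ ≤ ENNReal.ofReal (tailConst n M) * diniSum ω := by
        rw [← Finset.sum_mul, ← ENNReal.ofReal_sum_of_nonneg fun _ _ => abs_nonneg _]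
        exact mul_le_of_le_one_left' (ENNReal.ofReal_le_one.2 h.sum_abs_le)

end IsDecomposition

lemma enorm_sum_mul_le {s : Finset ι} {μ u : ι → ℝ} {v : ι → ℝ≥0∞} {D : ℝ≥0∞}
    (h : ∀ k ∈ s, ‖u k‖ₑ ≤ D * v k) : ‖∑ k ∈ s, μ k * u k‖ₑ ≤ D * ∑ k ∈ s, ‖μ k‖ₑ * v k := by
  refine (enorm_sum_le _ _).trans ?_
  rw [Finset.mul_sum]
  refine Finset.sum_le_sum fun k hk => ?_
  rw [enorm_mul, mul_left_comm]
  gcongr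
  exact h k hk

end Main

section WeakType

variable {n : ℕ} {ι κ : Type*} {T : (Rn n → ℝ) → (Rn n → ℝ) → Rn n → ℝ} {b : Rn n → ℝ}
  {α M : ℝ} {F₁ F₂ : Rn n → ℝ≥0∞} {g₁ g₂ : Rn n → ℝ} {s₁ : Finset ι} {s₂ : Finset κ}
  {c₁ : ι → Rn n} {l₁ μ₁ : ι → ℝ} {a₁ : ι → Rn n → ℝ} {c₂ : κ → Rn n} {l₂ μ₂ : κ → ℝ}
  {a₂ : κ → Rn n → ℝ}

lemma IsDecomposition.integrable_mul_add (hb : LocallyIntegrable b volume)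
    (h₁ : IsDecomposition α F₁ g₁ s₁ c₁ l₁ μ₁ a₁) :
    Integrable fun y => b y * (g₁ y + ∑ j ∈ s₁, μ₁ j * a₁ j y) := by
  have hbg := integrable_sub_const_mul hb h₁.measurable h₁.abs_le h₁.hasCompactSupport 0
  have hba : ∀ j, Integrable fun y => b y * a₁ j y := fun j => by
    simpa using (h₁.atom j).integrable_mul hb 0
  simp only [sub_zero] at hbg
  refine (hbg.add (integrable_finsetSum s₁ fun j _ => (hba j).const_mul (μ₁ j))).congr
    (ae_of_all _ fun y => ?_)
  simp only [Pi.add_apply]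
  rw [mul_add, Finset.mul_sum]
  simp only [mul_left_comm]

lemma IsDecomposition.commutator_eq (hB : Bilin2 T) (hb : LocallyIntegrable b volume)
    (h₁ : IsDecomposition α F₁ g₁ s₁ c₁ l₁ μ₁ a₁) (h₂ : IsDecomposition α F₂ g₂ s₂ c₂ l₂ μ₂ a₂)
    {f₁ f₂ : Rn n → ℝ} (hf₁ : f₁ = fun y => g₁ y + ∑ j ∈ s₁, μ₁ j * a₁ j y)
    (hf₂ : f₂ = fun y => g₂ y + ∑ k ∈ s₂, μ₂ k * a₂ k y) (x : Rn n) :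
    b x * T f₁ f₂ x - T (fun y => b y * f₁ y) f₂ x =
      (b x * T g₁ g₂ x - T (fun y => b y * g₁ y) g₂ x) +
      ∑ k ∈ s₂, μ₂ k * ((b x - avgOn b (cube (c₂ k) (l₂ k))) * T g₁ (a₂ k) x -
        T (fun y => (b y - avgOn b (cube (c₂ k) (l₂ k))) * g₁ y) (a₂ k) x) +
      ∑ j ∈ s₁, μ₁ j * ((b x - avgOn b (cube (c₁ j) (l₁ j))) * T (a₁ j) f₂ x) -
      T (fun y => ∑ j ∈ s₁, μ₁ j * ((b y - avgOn b (cube (c₁ j) (l₁ j))) * a₁ j y)) f₂ x := by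
  have hbg : Integrable fun y => b y * g₁ y := by
    simpa using integrable_sub_const_mul hb h₁.measurable h₁.abs_le h₁.hasCompactSupport 0
  have hba : ∀ j, Integrable fun y => b y * a₁ j y := fun j => by
    simpa using (h₁.atom j).integrable_mul hb 0
  have hbS : Integrable fun y => ∑ j ∈ s₁, μ₁ j * (b y * a₁ j y) :=
    integrable_finsetSum s₁ fun j _ => (hba j).const_mul _
  have hf₂i : Integrable f₂ := hf₂ ▸ h₂.integrable_add
  have e1 : T f₁ f₂ x = T g₁ f₂ x + ∑ j ∈ s₁, μ₁ j * T (a₁ j) f₂ x := by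
    rw [hf₁, hB.1 _ _ _ h₁.integrable h₁.integrable_sum hf₂i,
      hB.sum_left s₁ μ₁ (fun j _ => (h₁.atom j).integrable) hf₂i]
  have e2 : T (fun y => b y * f₁ y) f₂ x =
      T (fun y => b y * g₁ y) f₂ x + ∑ j ∈ s₁, μ₁ j * T (fun y => b y * a₁ j y) f₂ x := by
    have : (fun y => b y * f₁ y) =
        fun y => b y * g₁ y + ∑ j ∈ s₁, μ₁ j * (b y * a₁ j y) := by
      funext y
      rw [hf₁, mul_add, Finset.mul_sum]
      simp only [mul_left_comm]
    rw [this, hB.1 _ _ _ hbg hbS hf₂i, hB.sum_left s₁ μ₁ (fun j _ => hba j) hf₂i]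
  have e3 : ∀ {u : Rn n → ℝ}, Integrable u →
      T u f₂ x = T u g₂ x + ∑ k ∈ s₂, μ₂ k * T u (a₂ k) x := fun hu => by
    rw [hf₂, hB.2.2.1 _ _ _ hu h₂.integrable h₂.integrable_sum]
    congr 1
    exact hB.swap.sum_left s₂ μ₂ (fun k _ => (h₂.atom k).integrable) hu x
  have e4 := hB.sum_left s₁ μ₁
    (fun j _ => (h₁.atom j).integrable_mul hb (avgOn b (cube (c₁ j) (l₁ j)))) hf₂i x
  have e5 : ∀ k, (b x - avgOn b (cube (c₂ k) (l₂ k))) * T g₁ (a₂ k) x -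
      T (fun y => (b y - avgOn b (cube (c₂ k) (l₂ k))) * g₁ y) (a₂ k) x =
      b x * T g₁ (a₂ k) x - T (fun y => b y * g₁ y) (a₂ k) x := fun k =>
    (hB.commutator_sub_const h₁.integrable hbg (h₂.atom k).integrable _ x).symm
  have e6 : ∀ j, b x * T (a₁ j) f₂ x - T (fun y => b y * a₁ j y) f₂ x =
      (b x - avgOn b (cube (c₁ j) (l₁ j))) * T (a₁ j) f₂ x -
        T (fun y => (b y - avgOn b (cube (c₁ j) (l₁ j))) * a₁ j y) f₂ x := fun j =>
    hB.commutator_sub_const (h₁.atom j).integrable (hba j) hf₂i _ x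
  have e7 : b x * ∑ j ∈ s₁, μ₁ j * T (a₁ j) f₂ x -
      ∑ j ∈ s₁, μ₁ j * T (fun y => b y * a₁ j y) f₂ x =
      ∑ j ∈ s₁, μ₁ j * ((b x - avgOn b (cube (c₁ j) (l₁ j))) * T (a₁ j) f₂ x) -
      ∑ j ∈ s₁, μ₁ j * T (fun y => (b y - avgOn b (cube (c₁ j) (l₁ j))) * a₁ j y) f₂ x := by
    rw [Finset.mul_sum, ← Finset.sum_sub_distrib, ← Finset.sum_sub_distrib]
    refine Finset.sum_congr rfl fun j _ => ?_
    rw [← mul_sub, ← e6]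
    ring
  have e8 : b x * ∑ k ∈ s₂, μ₂ k * T g₁ (a₂ k) x -
      ∑ k ∈ s₂, μ₂ k * T (fun y => b y * g₁ y) (a₂ k) x =
      ∑ k ∈ s₂, μ₂ k * (b x * T g₁ (a₂ k) x - T (fun y => b y * g₁ y) (a₂ k) x) := by
    rw [Finset.mul_sum, ← Finset.sum_sub_distrib]
    refine Finset.sum_congr rfl fun k _ => ?_
    ring
  simp only [e5]
  rw [e4, e1, e2, e3 h₁.integrable, e3 hbg]
  linear_combination e7 + e8

/-- The constant in the pointwise bounds for the commutator outside the exceptional set. -/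
def pointwiseConst (n : ℕ) : ℝ := 4 ^ (n + 1) * (1 + goodConst n * (32 ^ n * (n + 5)))

lemma pointwiseConst_pos (n : ℕ) : 0 < pointwiseConst n := by
  have := goodConst_pos n
  unfold pointwiseConst; positivity

/-- The constant in the weak type estimate for the commutator. -/
def weakConst (n : ℕ) (M S : ℝ) : ℝ :=
  3 * goodConst n + (3 * M) ^ ((1:ℝ)/2) + 2 * maximalConst n +
    6 * (pointwiseConst n * (tailConst n M * S))

lemma tailConst_nonneg (n : ℕ) (hM : 0 ≤ M) : 0 ≤ tailConst n M := by
  unfold tailConst; positivity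

variable {C₀ C₁ C₂ lam : ℝ} {ω : ℝ → ℝ} {K : Rn n → Rn n → Rn n → ℝ}

lemma volume_lt_sum_mul_atomTail_le (hω0 : ∀ t, 0 < t → 0 ≤ ω t) (hω : diniSum ω < ∞)
    (hC₀ : 0 < C₀) (hM : 0 ≤ M) (hb : LocallyIntegrable b volume) (hO : OscBound b M)
    (h₁ : IsDecomposition α F₁ g₁ s₁ c₁ l₁ μ₁ a₁) (h₂ : IsDecomposition α F₂ g₂ s₂ c₂ l₂ μ₂ a₂)
    (hα : 0 < α) (hlam : 0 < lam) (hC₀α : C₀ * α ^ 2 ≤ lam) :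
    volume {x | ENNReal.ofReal (lam / 3) ≤ ENNReal.ofReal (C₀ * (pointwiseConst n * α)) *
      (∑ k ∈ s₂, ‖μ₂ k‖ₑ * atomTail ω b M (c₂ k) (l₂ k) x +
        ∑ j ∈ s₁, ‖μ₁ j‖ₑ * atomTail ω b M (c₁ j) (l₁ j) x)} ≤
    ENNReal.ofReal (6 * (pointwiseConst n * (tailConst n M * (diniSum ω).toReal)) / α) := by
  have hm₁ : AEMeasurable fun x => ∑ j ∈ s₁, ‖μ₁ j‖ₑ * atomTail ω b M (c₁ j) (l₁ j) x :=
    Finset.aemeasurable_fun_sum _ fun k _ => (aemeasurable_atomTail hb).const_mul _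
  have hm₂ : AEMeasurable fun x => ∑ k ∈ s₂, ‖μ₂ k‖ₑ * atomTail ω b M (c₂ k) (l₂ k) x :=
    Finset.aemeasurable_fun_sum _ fun k _ => (aemeasurable_atomTail hb).const_mul _
  have hp := pointwiseConst_pos n
  have ht := tailConst_nonneg n hM
  have hS : 0 ≤ (diniSum ω).toReal := ENNReal.toReal_nonneg
  refine (meas_ge_le_lintegral_div ((hm₂.add hm₁).const_mul _)
    (by simpa using hlam) ENNReal.ofReal_ne_top).trans ?_
  simp only [Pi.add_apply]
  rw [lintegral_const_mul' _ _ ENNReal.ofReal_ne_top, lintegral_add_left' hm₂]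
  refine (ENNReal.div_le_div_right (mul_le_mul_right (add_le_add
    (h₂.lintegral_sum_atomTail_le hω0 hM hb hO) (h₁.lintegral_sum_atomTail_le hω0 hM hb hO))
    _) _).trans ?_
  rw [← ENNReal.ofReal_toReal hω.ne, ← ENNReal.ofReal_mul ht,
    ← ENNReal.ofReal_add (by positivity) (by positivity), ← ENNReal.ofReal_mul (by positivity),
    ← ENNReal.ofReal_div_of_pos (by positivity), ENNReal.toReal_ofReal hS]
  refine ENNReal.ofReal_le_ofReal ?_
  rw [div_le_div_iff₀ (by positivity) hα]
  have := mul_le_mul_of_nonneg_left hC₀α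
    (show 0 ≤ pointwiseConst n * (tailConst n M * (diniSum ω).toReal) by positivity)
  nlinarith

theorem volume_lt_commutator_le (hn : 1 ≤ n) (hω0 : ∀ t, 0 < t → 0 ≤ ω t)
    (hωmono : ∀ s t : ℝ, 0 < s → s ≤ t → ω s ≤ ω t) (hω : diniSum ω < ∞)
    (hK : IsCZKernel2 C₀ ω K) (hT : KernelRep2 K T) (hB : Bilin2 T)
    (hC₀ : 0 < C₀) (hC₁ : 0 < C₁) (hC₂ : 0 < C₂) (hM : 0 ≤ M)
    (hb : LocallyIntegrable b volume) (hO : OscBound b M)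
    (hL2 : ∀ f g : Rn n → ℝ, Measurable f → Measurable g →
      (∃ A : ℝ, ∀ x, |f x| ≤ A) → (∃ A : ℝ, ∀ x, |g x| ≤ A) →
      HasCompactSupport f → HasCompactSupport g → ∀ lam : ℝ, 0 < lam →
      volume {x | lam < |b x * T f g x - T (fun y => b y * f y) g x|} ≤
        ENNReal.ofReal (C₁ * l2norm f * l2norm g / lam))
    (hL1 : ∀ f g : Rn n → ℝ, Integrable f → Integrable g → ∀ lam : ℝ, 0 < lam →
      volume {x | lam < |T f g x|} ≤
        ENNReal.ofReal ((C₂ * l1norm f * l1norm g / lam) ^ ((1:ℝ)/2)))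
    (h₁ : IsDecomposition α F₁ g₁ s₁ c₁ l₁ μ₁ a₁) (h₂ : IsDecomposition α F₂ g₂ s₂ c₂ l₂ μ₂ a₂)
    (hα : 0 < α) (hlam : 0 < lam) (hC₀α : C₀ * α ^ 2 ≤ lam) (hC₁α : C₁ * α ^ 2 ≤ lam)
    (hC₂α : C₂ * α ^ 2 ≤ lam)
    {f₁ f₂ : Rn n → ℝ} (hf₁ : f₁ = fun y => g₁ y + ∑ j ∈ s₁, μ₁ j * a₁ j y)
    (hf₂ : f₂ = fun y => g₂ y + ∑ k ∈ s₂, μ₂ k * a₂ k y) :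
    volume {x | lam < |b x * T f₁ f₂ x - T (fun y => b y * f₁ y) f₂ x|} ≤
      ENNReal.ofReal (weakConst n M (diniSum ω).toReal / α) := by
  have hκ := goodConst_pos n
  have hp := pointwiseConst_pos n
  have ht := tailConst_nonneg n hM
  have hS : 0 ≤ (diniSum ω).toReal := ENNReal.toReal_nonneg
  have hmc := maximalConst_nonneg n
  set e₁ := fun j => avgOn b (cube (c₁ j) (l₁ j)) with he₁
  set e₂ := fun k => avgOn b (cube (c₂ k) (l₂ k)) with he₂
  set H := fun y => ∑ j ∈ s₁, μ₁ j * ((b y - e₁ j) * a₁ j y) with hH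
  set G := fun x => ∑ k ∈ s₂, ‖μ₂ k‖ₑ * atomTail ω b M (c₂ k) (l₂ k) x +
    ∑ j ∈ s₁, ‖μ₁ j‖ₑ * atomTail ω b M (c₁ j) (l₁ j) x with hG
  set D := ENNReal.ofReal (C₀ * (pointwiseConst n * α)) with hD
  have hHi : Integrable H :=
    integrable_finsetSum s₁ fun j _ => ((h₁.atom j).integrable_mul hb _).const_mul _
  have hf₂i : Integrable f₂ := hf₂ ▸ h₂.integrable_add
  have hf₂c : HasCompactSupport f₂ := hf₂ ▸ h₂.hasCompactSupport_add
  have hf₂F : ∀ y, ‖f₂ y‖ₑ ≤ F₂ y := hf₂ ▸ h₂.enorm_add_le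
  set A := {x | lam / 3 < |b x * T g₁ g₂ x - T (fun y => b y * g₁ y) g₂ x|} with hA
  set A' := {x | lam / 3 < |T H f₂ x|} with hA'
  set A'' := {x | ENNReal.ofReal (lam / 3) ≤ D * G x} with hA''
  have bound_g : ∀ᵐ x, ∀ k ∈ s₂, x ∉ maximalSet F₁ α → x ∉ maximalSet F₂ α →
      ‖(b x - e₂ k) * T g₁ (a₂ k) x - T (fun y => (b y - e₂ k) * g₁ y) (a₂ k) x‖ₑ ≤
        D * atomTail ω b M (c₂ k) (l₂ k) x := by
    refine (Filter.eventually_all_finset s₂).2 fun k hk => ?_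
    filter_upwards [ae_enorm_commutator_atom_le hn hω0 hωmono hω hK.swap hT.swap hC₀ hM hb hO
      (h₂.atom k) h₁.measurable h₁.integrable h₁.hasCompactSupport h₁.enorm_le hα.le
      h₁.abs_le] with x hx hx₁ hx₂
    refine (hx hx₁ fun h => hx₂ (h₂.subset_maximalSet k hk h)).trans (le_of_eq ?_)
    rw [hD, pointwiseConst]
    congr 2
    ring
  have bound_a : ∀ᵐ x, ∀ j ∈ s₁, x ∉ maximalSet F₁ α → x ∉ maximalSet F₂ α →
      ‖(b x - e₁ j) * T (a₁ j) f₂ x‖ₑ ≤ D * atomTail ω b M (c₁ j) (l₁ j) x := by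
    refine (Filter.eventually_all_finset s₁).2 fun j hj => ?_
    filter_upwards [ae_enorm_mul_atom_le hn hω0 hωmono hω hK hT hC₀ (b := b) (M := M)
      (h₁.atom j) hf₂i hf₂c hf₂F hα.le] with x hx hx₁ hx₂
    refine (hx hx₂ fun h => hx₁ (h₁.subset_maximalSet j hj h)).trans ?_
    refine mul_le_mul_left (ENNReal.ofReal_le_ofReal ?_) _
    rw [pointwiseConst, mul_assoc (4 ^ (n + 1))]
    gcongr
    exact le_mul_of_one_le_left hα.le (le_add_of_nonneg_right (by positivity))
  have hsub : {x | lam < |b x * T f₁ f₂ x - T (fun y => b y * f₁ y) f₂ x|} ≤ᵐ[volume]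
      (A ∪ A' ∪ (maximalSet F₁ α ∪ maximalSet F₂ α) ∪ A'' : Set (Rn n)) := by
    filter_upwards [bound_g, bound_a] with x hg ha hx
    by_contra hcon
    have hcon' : ¬(x ∈ A ∪ A' ∪ (maximalSet F₁ α ∪ maximalSet F₂ α) ∪ A'') := hcon
    simp only [mem_union, not_or] at hcon'
    obtain ⟨⟨⟨hxA, hxA'⟩, hx₁, hx₂⟩, hxA''⟩ := hcon'
    have hx' : lam < |b x * T f₁ f₂ x - T (fun y => b y * f₁ y) f₂ x| := hx
    rw [h₁.commutator_eq hB hb h₂ hf₁ hf₂ x] at hx'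
    have hsum := (enorm_add_le _ _).trans (add_le_add
      (enorm_sum_mul_le (μ := μ₂) fun k hk => hg k hk hx₁ hx₂)
      (enorm_sum_mul_le (μ := μ₁) fun j hj => ha j hj hx₁ hx₂))
    rw [← mul_add] at hsum
    have hlt := hsum.trans_lt (not_le.1 hxA'')
    rw [Real.enorm_eq_ofReal_abs, ENNReal.ofReal_lt_ofReal_iff (by positivity)] at hlt
    simp only [hA, hA', mem_ofPred_eq, not_lt] at hxA hxA'
    rw [abs_le] at hxA hxA'
    rw [abs_lt] at hlt
    rw [lt_abs] at hx'
    rcases hx' with h | h <;> linarith [hxA.1, hxA.2, hxA'.1, hxA'.2, hlt.1, hlt.2]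
  have hvA : volume A ≤ ENNReal.ofReal (3 * goodConst n / α) := by
    refine (hL2 g₁ g₂ h₁.measurable h₂.measurable ⟨_, h₁.abs_le⟩ ⟨_, h₂.abs_le⟩
      h₁.hasCompactSupport h₂.hasCompactSupport _ (by positivity)).trans
      (ENNReal.ofReal_le_ofReal ?_)
    have hl0 : 0 ≤ l2norm g₂ := Real.rpow_nonneg (integral_nonneg fun x => sq_nonneg _) _
    have h3 : l2norm g₁ * l2norm g₂ ≤ goodConst n * α := by
      refine (mul_le_mul (h₁.l2norm_le hα) (h₂.l2norm_le hα) hl0 (by positivity)).trans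
        (le_of_eq ?_)
      rw [← Real.rpow_add (by positivity)]
      norm_num
    rw [div_le_div_iff₀ (by positivity) hα]
    have := mul_le_mul_of_nonneg_left h3 (show 0 ≤ C₁ * α by positivity)
    have := mul_le_mul_of_nonneg_left hC₁α hκ.le
    nlinarith
  have hvA' : volume A' ≤ ENNReal.ofReal ((3 * M) ^ ((1:ℝ)/2) / α) := by
    refine (hL1 H f₂ hHi hf₂i _ (by positivity)).trans (ENNReal.ofReal_le_ofReal ?_)
    have h3 : l1norm H ≤ M := h₁.l1norm_sum_le hM hb hO
    have h4 : l1norm f₂ ≤ 1 := hf₂ ▸ h₂.l1norm_add_le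
    have h5 : 0 ≤ l1norm H := integral_nonneg fun x => abs_nonneg _
    have h6 : 0 ≤ l1norm f₂ := integral_nonneg fun x => abs_nonneg _
    have h7 : α = (α ^ 2) ^ ((1:ℝ)/2) := by
      rw [← Real.sqrt_eq_rpow, Real.sqrt_sq hα.le]
    rw [h7, ← Real.div_rpow (by positivity) (by positivity)]
    refine Real.rpow_le_rpow (by positivity) ?_ (by norm_num)
    rw [div_le_div_iff₀ (by positivity) (by positivity)]
    have h8 : l1norm H * l1norm f₂ ≤ M := by
      simpa using mul_le_mul h3 h4 h6 hM
    have := mul_le_mul_of_nonneg_left h8 (show 0 ≤ C₂ * α ^ 2 by positivity)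
    have := mul_le_mul_of_nonneg_left hC₂α hM
    nlinarith
  have hvmax := add_le_add (volume_maximalSet_le hn h₁.lintegral_le hα)
    (volume_maximalSet_le hn h₂.lintegral_le hα)
  have hvA'' : volume A'' ≤
      ENNReal.ofReal (6 * (pointwiseConst n * (tailConst n M * (diniSum ω).toReal)) / α) :=
    volume_lt_sum_mul_atomTail_le hω0 hω hC₀ hM hb hO h₁ h₂ hα hlam hC₀α
  refine (measure_mono_ae hsub).trans ?_
  refine (measure_union_le _ _).trans ((add_le_add ((measure_union_le _ _).trans
    (add_le_add ((measure_union_le _ _).trans (add_le_add hvA hvA'))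
      ((measure_union_le _ _).trans hvmax))) hvA'').trans (le_of_eq ?_))
  rw [← ENNReal.ofReal_add (by positivity) (by positivity),
    ← ENNReal.ofReal_add (by positivity) (by positivity),
    ← ENNReal.ofReal_add (by positivity) (by positivity),
    ← ENNReal.ofReal_add (by positivity) (by positivity), weakConst]
  congr 1
  ring

lemma weakConst_nonneg (n : ℕ) (hM : 0 ≤ M) {S : ℝ} (hS : 0 ≤ S) : 0 ≤ weakConst n M S := by
  have := goodConst_pos n
  have := pointwiseConst_pos n
  have := tailConst_nonneg n hM
  have := maximalConst_nonneg n
  unfold weakConst; positivity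

end WeakType

/-- The commutator `T_b(f₁,f₂) = b·T(f₁,f₂) − T(b f₁, f₂)` of a bilinear
Calderón–Zygmund operator of `ω` type, with `ω` non-decreasing satisfying the log-Dini(1)
condition and `b ∈ BMO`, maps pairs of finite atomic sums (`H¹`-normalized) into weak
`L^{1/2}`, with constant `C·(C₀+C₁+C₂)^{1/2}` depending only on `n`, `ω` and the BMO bound. -/
theorem stmt0 (n : ℕ) (hn : 1 ≤ n) (ω : ℝ → ℝ)
    (hω0 : ∀ t, 0 < t → 0 ≤ ω t)
    (hωmono : ∀ s t : ℝ, 0 < s → s ≤ t → ω s ≤ ω t)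
    (hω_logDini : IntegrableOn (fun t => ω t * (1 + Real.log (1 / t)) / t) (Ioo (0:ℝ) 1))
    (M : ℝ) (hM0 : 0 ≤ M) :
    ∃ C : ℝ, 0 < C ∧
      ∀ (C₀ C₁ C₂ : ℝ) (K : Rn n → Rn n → Rn n → ℝ)
        (T : (Rn n → ℝ) → (Rn n → ℝ) → Rn n → ℝ) (b : Rn n → ℝ),
        0 < C₀ → 0 < C₁ → 0 < C₂ →
        IsCZKernel2 C₀ ω K →
        (∀ f g : Rn n → ℝ, Integrable f → Integrable g → Measurable (T f g)) →
        Bilin2 T →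
        KernelRep2 K T →
        LocallyIntegrable b volume → OscBound b M →
        -- weak `L²×L² → L^{1,∞}` bound for the commutator `T_b`
        (∀ f g : Rn n → ℝ, Measurable f → Measurable g →
          (∃ A : ℝ, ∀ x, |f x| ≤ A) → (∃ A : ℝ, ∀ x, |g x| ≤ A) →
          HasCompactSupport f → HasCompactSupport g →
          ∀ lam : ℝ, 0 < lam →
            volume {x | lam < |b x * T f g x - T (fun y => b y * f y) g x|} ≤
              ENNReal.ofReal (C₁ * l2norm f * l2norm g / lam)) →
        -- weak `L¹×L¹ → L^{1/2,∞}` bound for `T`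
        (∀ f g : Rn n → ℝ, Integrable f → Integrable g → ∀ lam : ℝ, 0 < lam →
            volume {x | lam < |T f g x|} ≤
              ENNReal.ofReal ((C₂ * l1norm f * l1norm g / lam) ^ ((1:ℝ)/2))) →
        ∀ f₁ f₂ : Rn n → ℝ, FiniteAtomicSum f₁ → FiniteAtomicSum f₂ →
        ∀ lam : ℝ, 0 < lam →
          volume {x | lam < |b x * T f₁ f₂ x - T (fun y => b y * f₁ y) f₂ x|} ≤
            ENNReal.ofReal (C * (C₀ + C₁ + C₂) ^ ((1:ℝ)/2) * lam ^ (-(1:ℝ)/2)) := by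
  have hω := diniSum_lt_top hω0 hωmono hω_logDini
  have hw := weakConst_nonneg n hM0 (ENNReal.toReal_nonneg (a := diniSum ω))
  refine ⟨weakConst n M (diniSum ω).toReal + 1, by positivity, ?_⟩
  intro C₀ C₁ C₂ K T b hC₀ hC₁ hC₂ hK _ hB hT hb hO hL2 hL1 f₁ f₂ hf₁ hf₂ lam hlam
  have hA : 0 < C₀ + C₁ + C₂ := by positivity
  set α := (lam / (C₀ + C₁ + C₂)) ^ ((1:ℝ)/2) with hα
  have hα0 : 0 < α := by positivity
  have hα2 : (C₀ + C₁ + C₂) * α ^ 2 = lam := by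
    rw [hα, ← Real.sqrt_eq_rpow, Real.sq_sqrt (by positivity), mul_div_cancel₀ _ hA.ne']
  have hαinv : α⁻¹ = (C₀ + C₁ + C₂) ^ ((1:ℝ)/2) * lam ^ (-(1:ℝ)/2) := by
    rw [hα, Real.div_rpow hlam.le hA.le, inv_div, neg_div, Real.rpow_neg hlam.le, div_eq_mul_inv]
  obtain ⟨F₁, g₁, N₁, s₁, c₁, l₁, μ₁, a₁, h₁, hae₁⟩ :=
    hf₁.exists_isDecomposition (by omega) hα0
  obtain ⟨F₂, g₂, N₂, s₂, c₂, l₂, μ₂, a₂, h₂, hae₂⟩ :=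
    hf₂.exists_isDecomposition (by omega) hα0
  have hT₁ := hB.congr_ae hL1 h₁.integrable_add h₂.integrable_add hae₁.symm hae₂.symm
  have hT₂ := hB.congr_ae hL1 (h₁.integrable_mul_add hb) h₂.integrable_add
    (f' := fun y => b y * f₁ y) (hae₁.symm.mono fun y hy => by simp only [hy]) hae₂.symm
  have hsub : {x | lam < |b x * T f₁ f₂ x - T (fun y => b y * f₁ y) f₂ x|} ≤ᵐ[volume]
      ({x | lam < |b x * T (fun y => g₁ y + ∑ j ∈ s₁, μ₁ j * a₁ j y)
        (fun y => g₂ y + ∑ k ∈ s₂, μ₂ k * a₂ k y) x -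
        T (fun y => b y * (g₁ y + ∑ j ∈ s₁, μ₁ j * a₁ j y))
          (fun y => g₂ y + ∑ k ∈ s₂, μ₂ k * a₂ k y) x|} : Set (Rn n)) := by
    filter_upwards [hT₁, hT₂] with x hx₁ hx₂ hx
    have hx' : lam < |b x * T f₁ f₂ x - T (fun y => b y * f₁ y) f₂ x| := hx
    rw [← hx₁, ← hx₂] at hx'
    exact hx'
  have hα' : 0 < α ^ 2 := by positivity
  refine (measure_mono_ae hsub).trans ((volume_lt_commutator_le hn hω0 hωmono hω hK hT hB hC₀ hC₁
    hC₂ hM0 hb hO hL2 hL1 h₁ h₂ hα0 hlam (by nlinarith) (by nlinarith) (by nlinarith) rfl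
    rfl).trans (ENNReal.ofReal_le_ofReal ?_))
  rw [mul_assoc, ← hαinv, div_eq_mul_inv]
  gcongr
  exact le_add_of_nonneg_right zero_le_one
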